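/- arXiv:math/9712294 — 12 statements merged into one kernel-verified Lean document; each statement's English description precedes it below -/
import Mathlib

section
/- The generalized Witt algebra W(n,i*) is a simple Lie algebra. -/
lemma simple_aux {F R : Type*} [Field F] [CharZero F] [CommRing R] [IsDomain R] [Algebra F R]
    (W : LieSubalgebra F (Derivation F R R))
    (hs : ∀ (r : R) (d : Derivation F R R), d ∈ W → r • d ∈ W)
    (hab : ¬ IsLieAbelian W)
    (hD : ∀ J : Ideal R, (∀ d ∈ W, ∀ h ∈ J, d h ∈ J) → (∃ h ∈ J, h ≠ 0) → (1 : R) ∈ J) :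
    LieAlgebra.IsSimple F W := by
  refine { eq_bot_or_eq_top := ?_, non_abelian := hab }
  intro L
  by_cases hL : L = ⊥
  · exact Or.inl hL
  right
  obtain ⟨d, hdL, hd0⟩ := (Submodule.ne_bot_iff L.toSubmodule).1 (by simpa using hL)
  -- the set of derivations underlying the ideal
  let P : Submodule F (Derivation F R R) := L.toSubmodule.map W.toSubmodule.subtype
  have hP : ∀ x (hx : x ∈ W), x ∈ P ↔ (⟨x, hx⟩ : W) ∈ L := by
    intro x hx
    constructor
    · rintro ⟨y, hy, rfl⟩; exact hy
    · intro h; exact ⟨_, h, rfl⟩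
  have hPW : ∀ x ∈ P, x ∈ W := by
    rintro x ⟨y, hy, rfl⟩; exact y.2
  have hbr : ∀ x ∈ P, ∀ y ∈ W, ⁅x, y⁆ ∈ P := by
    intro x hx y hy
    have h1 := lie_mem_left F W L ⟨x, hPW x hx⟩ ⟨y, hy⟩ ((hP x (hPW x hx)).1 hx)
    exact ⟨_, h1, rfl⟩
  have hls : ∀ (x y : Derivation F R R) (r : R), ⁅x, r • y⁆ = x r • y + r • ⁅x, y⁆ := by
    intro x y r; ext z
    simp [Derivation.commutator_apply]; ring
  have hsl : ∀ (x y : Derivation F R R) (r : R), ⁅r • x, y⁆ = r • ⁅x, y⁆ - y r • x := by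
    intro x y r; ext z
    simp [Derivation.commutator_apply]; ring
  obtain ⟨d, hdW⟩ := d
  have hdP : d ∈ P := (hP d hdW).2 hdL
  have hd0 : d ≠ 0 := fun h => hd0 (Subtype.ext h)
  have h2 : (2 : R) ≠ 0 := by
    have : CharZero R := charZero_of_injective_algebraMap (algebraMap F R).injective
    exact two_ne_zero
  obtain ⟨r0, hr0⟩ : ∃ r, d r ≠ 0 := by
    by_contra! h; exact hd0 (Derivation.ext h)
  obtain ⟨r, hr⟩ : ∃ r, d (d r) ≠ 0 := by
    by_contra! h
    have := h (r0 * r0)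
    simp [h] at this
    have h3 : (2 : R) * (d r0 * d r0) = 0 := by linear_combination this
    simp [h2, hr0] at h3
  -- all multiples of `2 d²(r) d`
  have step1 : ∀ s : R, (s * (2 * d (d r))) • d ∈ P := by
    intro s
    have e1 : d r • d ∈ P := by
      have := hbr d hdP _ (hs r d hdW)
      simpa [hls] using this
    have e2 := hbr _ e1 _ (hs s d hdW)
    have e3 := hbr _ hdP _ (hs (d r * s) d hdW)
    have e4 := P.sub_mem e3 e2
    rw [hsl, hls, hls] at e4
    convert e4 using 1
    ext z; simp; ring
  set d' := (2 * d (d r)) • d with hd'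
  have hd'W : d' ∈ W := hs _ _ hdW
  have step1 : ∀ s : R, s • d' ∈ P := by
    intro s; rw [hd', smul_smul]; exact step1 s
  have step2 : ∀ (s : R) (E : Derivation F R R), E ∈ W → s • ⁅d', E⁆ ∈ P := by
    intro s E hE
    have := P.add_mem (hbr _ (step1 s) E hE) (step1 (E s))
    rw [hsl] at this
    simpa using this
  have step3 : ∀ (s q : R) (E : Derivation F R R), E ∈ W → (s * d' q) • E ∈ P := by
    intro s q E hE
    have := P.sub_mem (step2 s _ (hs q E hE)) (step2 (s * q) E hE)
    rw [hls] at this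
    convert this using 1
    ext z; simp; ring
  let J : Ideal R :=
    { carrier := {h | ∀ s : R, ∀ E ∈ W, (s * h) • E ∈ P}
      add_mem' := by
        intro a b ha hb s E hE
        have := P.add_mem (ha s E hE) (hb s E hE)
        rwa [← add_smul, ← mul_add] at this
      zero_mem' := by intro s E hE; simp
      smul_mem' := by
        intro c x hx s E hE
        have := hx (s * c) E hE
        rwa [mul_assoc] at this }
  have h1 : (1 : R) ∈ J := by
    apply hD J
    · intro x hx h hh s E hE
      have e1 := hbr _ (hh 1 _ (hs s E hE)) x hx
      have e2 := hh 1 _ (W.lie_mem (hs s E hE) hx)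
      have := P.sub_mem e2 e1
      rw [hsl _ _ (1 * h)] at this
      convert this using 1
      ext z; simp; ring
    · refine ⟨d' r0, fun s E hE => step3 s r0 E hE, ?_⟩
      simp [hd', h2, hr, hr0]
  rw [eq_top_iff]
  rintro ⟨x, hx⟩ -
  rw [← hP]
  simpa using h1 1 x hx

section aux
variable {F : Type*} [Field F] {n : ℕ} {m : Fin n → ℕ} {idx : (t : Fin n) → Fin (m t) → ℕ}
    {D : Fin n →
      Derivation F (AddMonoidAlgebra F ((((t : Fin n) × Fin (m t)) → ℤ) × (Fin n → ℕ)))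
        (AddMonoidAlgebra F ((((t : Fin n) × Fin (m t)) → ℤ) × (Fin n → ℕ)))}

lemma coeffD
    (hD : ∀ (t : Fin n) (a : ((u : Fin n) × Fin (m u)) → ℤ) (j : Fin n → ℕ),
      D t (AddMonoidAlgebra.single (a, j) (1 : F)) =
        (∑ s : Fin (m t), (a ⟨t, s⟩ * (idx t s : ℤ)) •
          AddMonoidAlgebra.single (a, j + (idx t s - 1) • Pi.single t 1) (1 : F))
        + (j t : ℤ) • AddMonoidAlgebra.single (a, j - Pi.single t 1) (1 : F))
    (t : Fin n) (f : AddMonoidAlgebra F ((((t : Fin n) × Fin (m t)) → ℤ) × (Fin n → ℕ)))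
    (a : ((u : Fin n) × Fin (m u)) → ℤ) (k : Fin n → ℕ) :
    (D t f).coeff (a, k) =
      (∑ s : Fin (m t), ((a ⟨t, s⟩ : F) * (idx t s : F)) *
        (if idx t s - 1 ≤ k t then f.coeff (a, k - (idx t s - 1) • Pi.single t 1) else 0))
      + ((k t : F) + 1) * f.coeff (a, k + Pi.single t 1) := by
  classical
  induction f using AddMonoidAlgebra.induction_linear with
  | zero => simp
  | add f g hf hg =>
    rw [Derivation.map_add, AddMonoidAlgebra.coeff_add, Finsupp.add_apply, hf, hg]
    simp only [AddMonoidAlgebra.coeff_add, Finsupp.add_apply]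
    rw [mul_add, add_add_add_comm, ← Finset.sum_add_distrib]
    congr 1
    refine Finset.sum_congr rfl fun s _ => ?_
    split_ifs <;> ring
  | single x r =>
    obtain ⟨b, j⟩ := x
    have : (AddMonoidAlgebra.single (b, j) r : AddMonoidAlgebra F ((((t : Fin n) × Fin (m t)) → ℤ) × (Fin n → ℕ))) = r • AddMonoidAlgebra.single (b, j) (1 : F) := by simp
    rw [this, Derivation.map_smul, hD]
    simp only [← Int.cast_smul_eq_zsmul F]
    simp only [AddMonoidAlgebra.coeff_smul, AddMonoidAlgebra.coeff_add, AddMonoidAlgebra.coeff_sum,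
      AddMonoidAlgebra.coeff_single, Finsupp.smul_apply, Finsupp.add_apply, Finsupp.finsetSum_apply,
      Finsupp.single_apply, smul_eq_mul, mul_add, Finset.mul_sum, Prod.mk.injEq]
    congr 1
    · refine Finset.sum_congr rfl fun s _ => ?_
      have hiff : j + (idx t s - 1) • Pi.single t 1 = k ↔
          (idx t s - 1 ≤ k t ∧ j = k - (idx t s - 1) • Pi.single t 1) := by
        generalize idx t s - 1 = p
        constructor
        · rintro rfl
          refine ⟨by simp, ?_⟩
          ext u; simp
        · rintro ⟨h1, h2⟩
          rw [h2]
          ext u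
          by_cases hu : u = t
          · subst hu; simp; omega
          · simp [hu]
      simp only [hiff]
      by_cases hb : b = a
      · rw [hb]
        by_cases h1 : idx t s - 1 ≤ k t
        · by_cases h2 : j = k - (idx t s - 1) • Pi.single t 1
          · rw [if_pos ⟨rfl, h1, h2⟩, if_pos h1, if_pos ⟨rfl, h2⟩]
            push_cast; ring
          · rw [if_neg (fun h => h2 h.2.2), if_pos h1, if_neg (fun h => h2 h.2)]
            ring
        · rw [if_neg (fun h => h1 h.2.1), if_neg h1]
          ring
      · simp only [hb, false_and, if_false, mul_zero, ite_self]
    · by_cases hb : b = a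
      · subst hb
        by_cases h : j = k + Pi.single t 1
        · subst h
          simp
          ring
        · have : (j t : F) = 0 ∨ ¬ (j - Pi.single t 1 = k) := by
            by_cases h0 : j t = 0
            · left; simp [h0]
            · right
              rintro rfl
              apply h
              ext u
              by_cases hu : u = t
              · subst hu; simp; omega
              · simp [hu]
          rcases this with h1 | h1 <;> simp [h, h1]
      · simp [hb]

lemma coeffD_zero
    (hD : ∀ (t : Fin n) (a : ((u : Fin n) × Fin (m u)) → ℤ) (j : Fin n → ℕ),
      D t (AddMonoidAlgebra.single (a, j) (1 : F)) =
        (∑ s : Fin (m t), (a ⟨t, s⟩ * (idx t s : ℤ)) •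
          AddMonoidAlgebra.single (a, j + (idx t s - 1) • Pi.single t 1) (1 : F))
        + (j t : ℤ) • AddMonoidAlgebra.single (a, j - Pi.single t 1) (1 : F))
    (t : Fin n) (f : AddMonoidAlgebra F ((((t : Fin n) × Fin (m t)) → ℤ) × (Fin n → ℕ)))
    (k : Fin n → ℕ) :
    (D t f).coeff (0, k) = ((k t : F) + 1) * f.coeff (0, k + Pi.single t 1) := by
  rw [coeffD hD]; simp

lemma one_mem_aux [CharZero F]
    (hpos : ∀ t s, 0 < idx t s)
    (hmono : ∀ t, StrictMono (idx t))
    (hD : ∀ (t : Fin n) (a : ((u : Fin n) × Fin (m u)) → ℤ) (j : Fin n → ℕ),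
      D t (AddMonoidAlgebra.single (a, j) (1 : F)) =
        (∑ s : Fin (m t), (a ⟨t, s⟩ * (idx t s : ℤ)) •
          AddMonoidAlgebra.single (a, j + (idx t s - 1) • Pi.single t 1) (1 : F))
        + (j t : ℤ) • AddMonoidAlgebra.single (a, j - Pi.single t 1) (1 : F))
    (J : Ideal (AddMonoidAlgebra F ((((t : Fin n) × Fin (m t)) → ℤ) × (Fin n → ℕ))))
    (hJ : ∀ t, ∀ h ∈ J, D t h ∈ J) (hne : ∃ h ∈ J, h ≠ 0) :
    (1 : AddMonoidAlgebra F ((((t : Fin n) × Fin (m t)) → ℤ) × (Fin n → ℕ))) ∈ J := by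
  classical
  let S : AddMonoidAlgebra F ((((t : Fin n) × Fin (m t)) → ℤ) × (Fin n → ℕ)) →
      Finset (((t : Fin n) × Fin (m t)) → ℤ) := fun f => f.coeff.support.image Prod.fst
  have hS : ∀ f a, a ∈ S f ↔ ∃ j, f.coeff (a, j) ≠ 0 := by
    intro f a; simp [S]
  have hSD : ∀ t f, S (D t f) ⊆ S f := by
    intro t f a ha
    rw [hS] at ha ⊢
    by_contra! h
    obtain ⟨j, hj⟩ := ha
    apply hj
    rw [coeffD hD]; simp [h]
  obtain ⟨c, hmin, f0, hf0J, hf00, hf0c⟩ : ∃ c : ℕ, (∀ g ∈ J, g ≠ 0 → c ≤ (S g).card) ∧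
      ∃ f ∈ J, f ≠ 0 ∧ (S f).card ≤ c := by
    have hex : ∃ c, ∃ f ∈ J, f ≠ 0 ∧ (S f).card ≤ c := by
      obtain ⟨h, h1, h2⟩ := hne
      exact ⟨_, h, h1, h2, le_rfl⟩
    exact ⟨Nat.find hex, fun g hg hg0 => Nat.find_min' hex ⟨g, hg, hg0, le_rfl⟩, Nat.find_spec hex⟩
  -- shift so that the exponent `0` occurs
  obtain ⟨f1, hf1J, hf1c, j1, hj1⟩ : ∃ f ∈ J, (S f).card ≤ c ∧ ∃ j, f.coeff (0, j) ≠ 0 := by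
    obtain ⟨⟨a, j⟩, haj⟩ : ∃ x, f0.coeff x ≠ 0 := by
      by_contra! h
      exact hf00 (AddMonoidAlgebra.ext (Finsupp.ext h))
    have key : ∀ b k, (AddMonoidAlgebra.single ((-a, 0) : (((t : Fin n) × Fin (m t)) → ℤ) × (Fin n → ℕ)) (1 : F) * f0).coeff (b, k)
        = f0.coeff (a + b, k) := by
      intro b k
      rw [AddMonoidAlgebra.coeff_single_mul_eq_mul_coeff (a + b, k), one_mul]
      rintro ⟨b', k'⟩ _
      simp only [Prod.mk_add_mk, Prod.mk.injEq, zero_add]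
      constructor
      · rintro ⟨rfl, rfl⟩; simp
      · rintro ⟨rfl, rfl⟩; simp
    refine ⟨AddMonoidAlgebra.single (-a, 0) (1 : F) * f0, J.mul_mem_left _ hf0J, ?_, j, ?_⟩
    · refine le_trans ?_ hf0c
      refine Finset.card_le_card_of_injOn (fun b => a + b) ?_ (fun x _ y _ h => by simpa using h)
      intro b hb
      simp only [Finset.mem_coe, hS, key] at hb ⊢
      exact hb
    · rw [key]; simpa using haj
  -- differentiate until the coefficient of `e^0` is constant
  have main : ∀ N : ℕ, ∀ f ∈ J, (S f).card ≤ c → ∀ j0 : Fin n → ℕ, ∑ t, j0 t = N →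
      f.coeff (0, j0) ≠ 0 → (∀ j, j0 < j → f.coeff (0, j) = 0) →
      ∃ f ∈ J, (S f).card ≤ c ∧ f.coeff (0, 0) ≠ 0 ∧ ∀ j, j ≠ 0 → f.coeff (0, j) = 0 := by
    intro N
    induction N with
    | zero =>
      intro f hf hc j0 hj0 h1 h2
      have : j0 = 0 := by ext t; simpa using (Finset.sum_eq_zero_iff.1 hj0) t (Finset.mem_univ t)
      subst this
      exact ⟨f, hf, hc, h1, fun j hj => h2 j (pos_iff_ne_zero.2 hj)⟩
    | succ N ih =>
      intro f hf hc j0 hj0 h1 h2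
      obtain ⟨t, ht⟩ : ∃ t, j0 t ≠ 0 := by
        by_contra! h; simp [h] at hj0
      obtain ⟨k, rfl⟩ : ∃ k : Fin n → ℕ, j0 = k + Pi.single t 1 := by
        refine ⟨j0 - Pi.single t 1, ?_⟩
        ext u
        by_cases hu : u = t
        · subst hu; simp; omega
        · simp [hu]
      refine ih (D t f) (hJ t f hf) ((Finset.card_le_card (hSD t f)).trans hc) k ?_ ?_ ?_
      · simp [Finset.sum_add_distrib] at hj0; exact hj0
      · rw [coeffD_zero hD]
        exact mul_ne_zero (Nat.cast_add_one_ne_zero _) h1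
      · intro j hj
        rw [coeffD_zero hD, h2, mul_zero]
        exact add_lt_add_left hj _
  obtain ⟨f, hfJ, hfc, hf0, hfj⟩ : ∃ f ∈ J, (S f).card ≤ c ∧ f.coeff (0, 0) ≠ 0 ∧
      ∀ j, j ≠ 0 → f.coeff (0, j) = 0 := by
    have hfin : Set.Finite {j | f1.coeff (0, j) ≠ 0} := by
      refine (f1.coeff.support.image Prod.snd).finite_toSet.subset ?_
      intro j hj
      simp only [Finset.coe_image, Set.mem_image, Finset.mem_coe, Finsupp.mem_support_iff]
      exact ⟨(0, j), hj, rfl⟩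
    obtain ⟨j0, hj0⟩ := hfin.exists_maximal ⟨j1, hj1⟩
    refine main _ f1 hf1J hf1c j0 rfl hj0.1 ?_
    intro j hj
    by_contra h
    exact absurd (hj0.2 (show j ∈ {j | f1.coeff (0, j) ≠ 0} from h) hj.le) hj.not_ge
  have hDf : ∀ t, D t f = 0 := by
    intro t
    by_contra h
    have h1 := hmin _ (hJ t f hfJ) h
    have h2 : (S (D t f)).card < (S f).card := by
      apply Finset.card_lt_card
      refine (Finset.ssubset_iff_of_subset (hSD t f)).2 ⟨0, (hS _ _).2 ⟨0, hf0⟩, ?_⟩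
      rw [hS]
      push Not
      intro j
      rw [coeffD_zero hD, hfj, mul_zero]
      intro h
      have := congrFun h t
      simp at this
    omega
  have hfa : ∀ a, a ≠ 0 → ∀ j, f.coeff (a, j) = 0 := by
    intro a ha j
    by_contra hj
    obtain ⟨⟨t, s0⟩, hs0⟩ : ∃ x, a x ≠ 0 := by
      by_contra! h; exact ha (funext h)
    obtain ⟨s, hs⟩ := (Set.toFinite {s : Fin (m t) | a ⟨t, s⟩ ≠ 0}).exists_maximal ⟨s0, hs0⟩
    have hfin : Set.Finite {j | f.coeff (a, j) ≠ 0} := by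
      refine (f.coeff.support.image Prod.snd).finite_toSet.subset ?_
      intro j hj
      simp only [Finset.coe_image, Set.mem_image, Finset.mem_coe, Finsupp.mem_support_iff]
      exact ⟨(a, j), hj, rfl⟩
    obtain ⟨k, hk, hkmax⟩ := hfin.exists_maximalFor (fun j => j t) _ ⟨j, hj⟩
    have hbig : ∀ j, k t < j t → f.coeff (a, j) = 0 := by
      intro j h
      by_contra h'
      exact absurd (hkmax (show j ∈ {j | f.coeff (a, j) ≠ 0} from h') h.le) h.not_ge
    have e := coeffD hD t f a (k + (idx t s - 1) • Pi.single t 1)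
    rw [hDf, Finset.sum_eq_single s, hbig (k + (idx t s - 1) • Pi.single t 1 + Pi.single t 1)] at e
    · have h1 : a ⟨t, s⟩ ≠ 0 := hs.1
      have h2 := (hpos t s).ne'
      have h3 : f.coeff (a, k) ≠ 0 := hk
      simp [h1, h2, h3] at e
    · simp
    · intro s' _ hs'
      rcases lt_or_gt_of_ne hs' with h | h
      · rw [hbig, ite_self, mul_zero]
        have := hmono t h
        have := hpos t s'
        simp
        omega
      · have : a ⟨t, s'⟩ = 0 := by
          by_contra h'
          exact absurd (hs.2 (show s' ∈ {s : Fin (m t) | a ⟨t, s⟩ ≠ 0} from h') h.le) h.not_ge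
        simp [this]
    · simp
  have hf1 : f = AddMonoidAlgebra.single 0 (f.coeff (0, 0)) := by
    apply AddMonoidAlgebra.ext
    ext ⟨a, j⟩
    rw [AddMonoidAlgebra.coeff_single, Finsupp.single_apply]
    split_ifs with h
    · rw [← h]; rfl
    · by_cases ha : a = 0
      · subst ha
        exact hfj j (fun h' => h (by rw [h']; rfl))
      · exact hfa a ha j
  have := J.mul_mem_left (AddMonoidAlgebra.single 0 (f.coeff (0, 0))⁻¹) hfJ
  generalize f.coeff (0, 0) = q at *
  rw [hf1, AddMonoidAlgebra.single_mul_single, inv_mul_cancel₀ hf0, add_zero] at this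
  exact this
end aux


/-- The generalized Witt algebra `W(n,i*)` is a simple Lie algebra.

Here `R` is the monoid algebra `F[ℤ^M × ℕ^n]`, with basis monomial
`e^{a_{1,1}x_1^{i_{1,1}}}⋯e^{a_{n,m_n}x_n^{i_{n,m_n}}}·x_1^{j_1}⋯x_n^{j_n}`
written `AddMonoidAlgebra.single (a, j) 1`, the derivation `∂_t` is `D t`
(characterized by its action on basis monomials), and `W(n,i*) = R∂_1 ⊕ ⋯ ⊕ R∂_n`
is the Lie subalgebra `W` of the `F`-derivations of `R`. -/
theorem generalized_witt_algebra_isSimple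
    (F : Type*) [Field F] [CharZero F]
    (n : ℕ) (hn : 0 < n)
    (m : Fin n → ℕ) (hm : ∀ t, 0 < m t)
    (idx : (t : Fin n) → Fin (m t) → ℕ)
    (hpos : ∀ t s, 0 < idx t s)
    (hmono : ∀ t, StrictMono (idx t))
    (D : Fin n →
      Derivation F (AddMonoidAlgebra F ((((t : Fin n) × Fin (m t)) → ℤ) × (Fin n → ℕ)))
        (AddMonoidAlgebra F ((((t : Fin n) × Fin (m t)) → ℤ) × (Fin n → ℕ))))
    (hD : ∀ (t : Fin n) (a : ((u : Fin n) × Fin (m u)) → ℤ) (j : Fin n → ℕ),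
      D t (AddMonoidAlgebra.single (a, j) (1 : F)) =
        (∑ s : Fin (m t), (a ⟨t, s⟩ * (idx t s : ℤ)) •
          AddMonoidAlgebra.single (a, j + (idx t s - 1) • Pi.single t 1) (1 : F))
        + (j t : ℤ) • AddMonoidAlgebra.single (a, j - Pi.single t 1) (1 : F))
    (W : LieSubalgebra F
      (Derivation F (AddMonoidAlgebra F ((((t : Fin n) × Fin (m t)) → ℤ) × (Fin n → ℕ)))
        (AddMonoidAlgebra F ((((t : Fin n) × Fin (m t)) → ℤ) × (Fin n → ℕ)))))
    (hW : (W : Set (Derivation F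
            (AddMonoidAlgebra F ((((t : Fin n) × Fin (m t)) → ℤ) × (Fin n → ℕ)))
            (AddMonoidAlgebra F ((((t : Fin n) × Fin (m t)) → ℤ) × (Fin n → ℕ))))) =
      {d | ∃ f : Fin n → AddMonoidAlgebra F ((((t : Fin n) × Fin (m t)) → ℤ) × (Fin n → ℕ)),
        d = ∑ t : Fin n, f t • D t}) :
    LieAlgebra.IsSimple F W := by
  classical
  have hmem : ∀ d, d ∈ W ↔ ∃ f : Fin n → AddMonoidAlgebra F ((((t : Fin n) × Fin (m t)) → ℤ) × (Fin n → ℕ)),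
        d = ∑ t : Fin n, f t • D t := by
    intro d
    rw [← SetLike.mem_coe, hW]; rfl
  have hs : ∀ (r : AddMonoidAlgebra F ((((t : Fin n) × Fin (m t)) → ℤ) × (Fin n → ℕ))) d,
      d ∈ W → r • d ∈ W := by
    intro r d hd
    rw [hmem] at hd ⊢
    obtain ⟨f, rfl⟩ := hd
    exact ⟨fun t => r * f t, by simp [Finset.smul_sum, smul_smul]⟩
  have hDW : ∀ t, D t ∈ W := by
    intro t
    rw [hmem]
    refine ⟨Pi.single t 1, ?_⟩
    rw [Finset.sum_eq_single t]
    · simp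
    · intro u _ hu; simp [hu]
    · simp
  refine simple_aux W hs ?_ ?_
  · intro hab
    let t : Fin n := ⟨0, hn⟩
    let x : AddMonoidAlgebra F ((((t : Fin n) × Fin (m t)) → ℤ) × (Fin n → ℕ)) :=
      AddMonoidAlgebra.single (0, Pi.single t 1) 1
    have hx : D t x = 1 := by
      simp only [x]
      rw [hD]
      simp [AddMonoidAlgebra.one_def]
      rfl
    have h1 := hab.trivial (⟨D t, hDW t⟩ : W) ⟨x • D t, hs x _ (hDW t)⟩
    have h2 : ⁅D t, x • D t⁆ = 0 := congrArg Subtype.val h1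
    have h3 := congrArg (fun d => d x) h2
    simp [Derivation.commutator_apply, hx] at h3
  · intro J hJ hne
    exact one_mem_aux hpos hmono hD J (fun t h hh => hJ _ (hDW t) h hh) hne
end

section
/- For every nonzero element l of W(n,i*), the Lie ideal of W(n,i*) generated by l contains a nonzero element l₁ that is an F-linear combination of basis elements e^{a_{1,1}x_1^{i_{1,1}}}⋯e^{a_{n,m_n}x_n^{i_{n,m_n}}}·x_1^{j_1}⋯x_n^{j_n}∂_t all of whose polynomial exponents j_1,…,j_n are positive integers. -/
set_option synthInstance.maxHeartbeats 1000000
set_option maxHeartbeats 1000000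

/-- For every nonzero `l` in `W(n,i*)`, the Lie ideal generated by `l`
contains a nonzero element `l₁` that is an `F`-linear combination of basis elements
`e^{a_{1,1}x_1^{i_{1,1}}}⋯e^{a_{n,m_n}x_n^{i_{n,m_n}}}·x_1^{j_1}⋯x_n^{j_n}∂_t`
all of whose polynomial exponents `j_1,…,j_n` are positive. -/
theorem generalized_witt_ideal_contains_positive_part
    (F : Type*) [Field F] [CharZero F]
    (n : ℕ) (hn : 0 < n)
    (m : Fin n → ℕ) (hm : ∀ t, 0 < m t)
    (idx : (t : Fin n) → Fin (m t) → ℕ)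
    (hpos : ∀ t s, 0 < idx t s)
    (hmono : ∀ t, StrictMono (idx t))
    (D : Fin n →
      Derivation F (AddMonoidAlgebra F ((((t : Fin n) × Fin (m t)) → ℤ) × (Fin n → ℕ)))
        (AddMonoidAlgebra F ((((t : Fin n) × Fin (m t)) → ℤ) × (Fin n → ℕ))))
    (hD : ∀ (t : Fin n) (a : ((u : Fin n) × Fin (m u)) → ℤ) (j : Fin n → ℕ),
      D t (AddMonoidAlgebra.single (a, j) (1 : F)) =
        (∑ s : Fin (m t), (a ⟨t, s⟩ * (idx t s : ℤ)) •
          AddMonoidAlgebra.single (a, j + (idx t s - 1) • Pi.single t 1) (1 : F))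
        + (j t : ℤ) • AddMonoidAlgebra.single (a, j - Pi.single t 1) (1 : F))
    (W : LieSubalgebra F
      (Derivation F (AddMonoidAlgebra F ((((t : Fin n) × Fin (m t)) → ℤ) × (Fin n → ℕ)))
        (AddMonoidAlgebra F ((((t : Fin n) × Fin (m t)) → ℤ) × (Fin n → ℕ)))))
    (hW : (W : Set (Derivation F
            (AddMonoidAlgebra F ((((t : Fin n) × Fin (m t)) → ℤ) × (Fin n → ℕ)))
            (AddMonoidAlgebra F ((((t : Fin n) × Fin (m t)) → ℤ) × (Fin n → ℕ))))) =
      {d | ∃ f : Fin n → AddMonoidAlgebra F ((((t : Fin n) × Fin (m t)) → ℤ) × (Fin n → ℕ)),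
        d = ∑ t : Fin n, f t • D t})
    (l : W) (hl : l ≠ 0) :
    ∃ l₁ ∈ LieSubmodule.lieSpan F W {l}, l₁ ≠ 0 ∧
      (l₁ : W) ∈ Submodule.span F
        {w : W | ∃ (a : ((u : Fin n) × Fin (m u)) → ℤ) (j : Fin n → ℕ) (t : Fin n),
          (∀ u : Fin n, 0 < j u) ∧
          (w : Derivation F
            (AddMonoidAlgebra F ((((t : Fin n) × Fin (m t)) → ℤ) × (Fin n → ℕ)))
            (AddMonoidAlgebra F ((((t : Fin n) × Fin (m t)) → ℤ) × (Fin n → ℕ)))) =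
            AddMonoidAlgebra.single (a, j) (1 : F) • D t} := by
  classical
  let R := AddMonoidAlgebra F ((((t : Fin n) × Fin (m t)) → ℤ) × (Fin n → ℕ))
  have memW : ∀ d : Derivation F R R, d ∈ W ↔ ∃ f : Fin n → R, d = ∑ t : Fin n, f t • D t := by
    intro d
    exact Set.ext_iff.1 hW d
  have fD_mem : ∀ (f : R) (t : Fin n), f • D t ∈ W := by
    intro f t
    refine (memW _).2 ⟨Pi.single t f, ?_⟩
    rw [Finset.sum_eq_single t]
    · simp
    · intro b _ hb
      rw [Pi.single_eq_of_ne hb, zero_smul]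
    · simp
  set S : Submodule F W := Submodule.span F
        {w : W | ∃ (a : ((u : Fin n) × Fin (m u)) → ℤ) (j : Fin n → ℕ) (t : Fin n),
          (∀ u : Fin n, 0 < j u) ∧
          (w : Derivation F R R) = AddMonoidAlgebra.single (a, j) (1 : F) • D t} with hS
  let M : R := AddMonoidAlgebra.single (0, fun _ => 1) (1 : F)
  have hM : M ≠ 0 := by
    intro h
    exact one_ne_zero (AddMonoidAlgebra.single_eq_zero.1 h)
  have posS : ∀ (f : R) (t : Fin n), (⟨(M * f) • D t, fD_mem _ _⟩ : W) ∈ S := by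
    intro f t
    induction f using AddMonoidAlgebra.induction_linear with
    | zero =>
      have : (⟨(M * 0) • D t, fD_mem _ _⟩ : W) = 0 := by
        apply Subtype.ext
        simp
      rw [this]
      exact S.zero_mem
    | add f g hf hg =>
      have : (⟨(M * (f + g)) • D t, fD_mem _ _⟩ : W) =
          ⟨(M * f) • D t, fD_mem _ _⟩ + ⟨(M * g) • D t, fD_mem _ _⟩ := by
        apply Subtype.ext
        simp [mul_add, add_smul]
      rw [this]
      exact S.add_mem hf hg
    | single x c =>
      obtain ⟨a, j⟩ := x
      have : (⟨(M * AddMonoidAlgebra.single (a, j) c) • D t, fD_mem _ _⟩ : W) =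
          c • ⟨(AddMonoidAlgebra.single (a, fun u => 1 + j u) (1 : F) : R) • D t, fD_mem _ _⟩ := by
        apply Subtype.ext
        show (M * AddMonoidAlgebra.single (a, j) c) • D t =
          c • ((AddMonoidAlgebra.single (a, fun u => 1 + j u) (1 : F) : R) • D t)
        rw [← smul_assoc]
        congr 1
        refine (AddMonoidAlgebra.single_mul_single _ _ _ _).trans
          (Eq.trans ?_ (AddMonoidAlgebra.smul_single _ _ _).symm)
        have h1 : ((0, fun _ => 1) + (a, j) :
            (((t : Fin n) × Fin (m t)) → ℤ) × (Fin n → ℕ)) = (a, fun u => 1 + j u) :=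
          Prod.ext (zero_add a) rfl
        rw [h1, one_mul, smul_eq_mul, mul_one]
      rw [this]
      refine S.smul_mem _ (Submodule.subset_span ⟨a, _, t, ?_, rfl⟩)
      intro u
      omega
  let p : Fin n := ⟨0, hn⟩
  have hx : D p (AddMonoidAlgebra.single (0, Pi.single p 1) (1 : F)) = (1 : R) := by
    rw [hD]
    simp
    exact AddMonoidAlgebra.one_def.symm
  have hlD : (l : Derivation F R R) ≠ 0 := fun h => hl (Subtype.ext h)
  have hDpW : D p ∈ W := by simpa using fD_mem 1 p
  obtain ⟨k, hk⟩ := (memW ⁅D p, (l : Derivation F R R)⁆).1 (W.lie_mem hDpW l.2)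
  have formula : ∀ G : R, ⁅G • D p, (l : Derivation F R R)⁆
      = G • ⁅D p, (l : Derivation F R R)⁆ - ((l : Derivation F R R) G) • D p := by
    intro G
    ext y : 1
    simp only [Derivation.commutator_apply, Derivation.smul_apply, Derivation.sub_apply,
      smul_eq_mul, Derivation.leibniz]
    ring
  let w : R → W := fun h => ⟨(M * (M * h)) • D p, fD_mem _ _⟩
  have inS : ∀ h : R, ⁅w h, l⁆ ∈ S := by
    intro h
    have key : ⁅w h, l⁆ = (∑ t, (⟨(M * (M * h * k t)) • D t, fD_mem _ _⟩ : W))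
        - ⟨(M * ((l : Derivation F R R) (M * h) + h * (l : Derivation F R R) M)) • D p,
            fD_mem _ _⟩ := by
      apply Subtype.ext
      rw [LieSubalgebra.coe_bracket]
      show ⁅(M * (M * h)) • D p, (l : Derivation F R R)⁆ = _
      rw [formula, hk, Finset.smul_sum]
      simp only [AddSubgroupClass.coe_sub, AddSubmonoidClass.coe_finsetSum]
      congr 1
      · refine Finset.sum_congr rfl fun t _ => ?_
        rw [smul_smul]
        congr 1
        ring
      · congr 1
        simp only [Derivation.leibniz, smul_eq_mul]
        ring
    rw [key]
    exact S.sub_mem (S.sum_mem fun t _ => posS _ _) (posS _ _)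
  have inI : ∀ h : R, ⁅w h, l⁆ ∈ LieSubmodule.lieSpan F W {l} := fun h =>
    LieSubmodule.lie_mem _ (LieSubmodule.subset_lieSpan rfl)
  by_contra hcon
  push Not at hcon
  have zero : ∀ h : R, ⁅w h, l⁆ = 0 := by
    intro h
    by_contra hne
    exact hcon _ (inI h) hne (inS h)
  have zero' : ∀ h : R, (M * (M * h)) • ⁅D p, (l : Derivation F R R)⁆
      = ((l : Derivation F R R) (M * (M * h))) • D p := by
    intro h
    rw [← sub_eq_zero, ← formula]
    exact congrArg Subtype.val (zero h)
  apply hlD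
  ext1 h
  have e1 := congrArg (fun d : Derivation F R R =>
    d (AddMonoidAlgebra.single (0, Pi.single p 1) (1 : F))) (zero' 1)
  have e2 := congrArg (fun d : Derivation F R R =>
    d (AddMonoidAlgebra.single (0, Pi.single p 1) (1 : F))) (zero' h)
  simp only [Derivation.smul_apply, hx, smul_eq_mul, mul_one, Derivation.leibniz] at e1 e2
  have e3 : M * (M * (l : Derivation F R R) h) = 0 := by
    linear_combination h * e1 - e2
  simpa [hM] using e3
end

section
/- If a Lie ideal I of W(n,i*) contains the derivations ∂_1, …, ∂_n, then I = W(n,i*). -/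
set_option synthInstance.maxHeartbeats 1000000
set_option maxHeartbeats 1000000

/-- If a Lie ideal `I` of `W(n,i*)` contains the derivations
`∂_1, …, ∂_n`, then `I = W(n,i*)`. -/
theorem generalized_witt_ideal_with_partials_is_top
    (F : Type*) [Field F] [CharZero F]
    (n : ℕ) (hn : 0 < n)
    (m : Fin n → ℕ) (hm : ∀ t, 0 < m t)
    (idx : (t : Fin n) → Fin (m t) → ℕ)
    (hpos : ∀ t s, 0 < idx t s)
    (hmono : ∀ t, StrictMono (idx t))
    (D : Fin n →
      Derivation F (AddMonoidAlgebra F ((((t : Fin n) × Fin (m t)) → ℤ) × (Fin n → ℕ)))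
        (AddMonoidAlgebra F ((((t : Fin n) × Fin (m t)) → ℤ) × (Fin n → ℕ))))
    (hD : ∀ (t : Fin n) (a : ((u : Fin n) × Fin (m u)) → ℤ) (j : Fin n → ℕ),
      D t (AddMonoidAlgebra.single (a, j) (1 : F)) =
        (∑ s : Fin (m t), (a ⟨t, s⟩ * (idx t s : ℤ)) •
          AddMonoidAlgebra.single (a, j + (idx t s - 1) • Pi.single t 1) (1 : F))
        + (j t : ℤ) • AddMonoidAlgebra.single (a, j - Pi.single t 1) (1 : F))
    (W : LieSubalgebra F
      (Derivation F (AddMonoidAlgebra F ((((t : Fin n) × Fin (m t)) → ℤ) × (Fin n → ℕ)))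
        (AddMonoidAlgebra F ((((t : Fin n) × Fin (m t)) → ℤ) × (Fin n → ℕ)))))
    (hW : (W : Set (Derivation F
            (AddMonoidAlgebra F ((((t : Fin n) × Fin (m t)) → ℤ) × (Fin n → ℕ)))
            (AddMonoidAlgebra F ((((t : Fin n) × Fin (m t)) → ℤ) × (Fin n → ℕ))))) =
      {d | ∃ f : Fin n → AddMonoidAlgebra F ((((t : Fin n) × Fin (m t)) → ℤ) × (Fin n → ℕ)),
        d = ∑ t : Fin n, f t • D t})
    (I : LieIdeal F W)
    (hI : ∀ (t : Fin n) (w : W),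
      (w : Derivation F
        (AddMonoidAlgebra F ((((t : Fin n) × Fin (m t)) → ℤ) × (Fin n → ℕ)))
        (AddMonoidAlgebra F ((((t : Fin n) × Fin (m t)) → ℤ) × (Fin n → ℕ)))) = D t → w ∈ I) :
    I = ⊤ := by
  classical
  have hmem : ∀ (q : Fin n) (f : AddMonoidAlgebra F ((((t : Fin n) × Fin (m t)) → ℤ) × (Fin n → ℕ))), f • D q ∈ W := by
    intro q f
    have : f • D q ∈ (W : Set _) := by
      rw [hW]
      refine ⟨Pi.single q f, ?_⟩
      rw [Finset.sum_eq_single q]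
      · simp
      · intro b _ hb
        simp [Pi.single_eq_of_ne hb]
      · simp
    exact this
  have key : ∀ (q : Fin n) (f : AddMonoidAlgebra F ((((t : Fin n) × Fin (m t)) → ℤ) × (Fin n → ℕ))), (⟨f • D q, hmem q f⟩ : W) ∈ I := by
    intro q
    obtain ⟨x, hx⟩ : ∃ x, D q x = 1 := by
      refine ⟨AddMonoidAlgebra.single (0, Pi.single q 1) 1, ?_⟩
      rw [hD]
      simp [AddMonoidAlgebra.one_def]
      rfl
    have h1 : ∀ f g : AddMonoidAlgebra F ((((t : Fin n) × Fin (m t)) → ℤ) × (Fin n → ℕ)), (⟨f • D q, hmem q f⟩ : W) ∈ I →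
        (⟨(f * D q g - g * D q f) • D q, hmem q _⟩ : W) ∈ I := by
      intro f g hf
      have h := lie_mem_left F W I _ (⟨g • D q, hmem q g⟩ : W) hf
      convert h using 1
      apply Subtype.ext
      rw [LieSubalgebra.coe_bracket]
      refine Derivation.ext fun y => ?_
      simp only [Derivation.commutator_apply, Derivation.smul_apply, smul_eq_mul,
        Derivation.leibniz]
      ring
    have hone : (⟨(1 : AddMonoidAlgebra F ((((t : Fin n) × Fin (m t)) → ℤ) × (Fin n → ℕ))) • D q, hmem q 1⟩ : W) ∈ I :=
      hI q _ (one_smul _ _)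
    have hd : ∀ g : AddMonoidAlgebra F ((((t : Fin n) × Fin (m t)) → ℤ) × (Fin n → ℕ)), (⟨(D q g) • D q, hmem q _⟩ : W) ∈ I := by
      intro g
      have h := h1 1 g hone
      convert h using 3
      simp
    have hsm : ∀ f : AddMonoidAlgebra F ((((t : Fin n) × Fin (m t)) → ℤ) × (Fin n → ℕ)), (⟨((2 : F) • f) • D q, hmem q _⟩ : W) ∈ I →
        (⟨f • D q, hmem q f⟩ : W) ∈ I := by
      intro f hf
      have h : _ ∈ I := I.smul_mem ((2 : F)⁻¹) hf
      convert h using 1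
      apply Subtype.ext
      simp [smul_smul, ← smul_assoc]
    have hxI : (⟨x • D q, hmem q x⟩ : W) ∈ I := by
      apply hsm
      have h := hd (x * x)
      convert h using 3
      simp [hx, two_smul]
    intro f
    apply hsm
    have h : _ ∈ I := sub_mem (hd (x * f)) (h1 x f hxI)
    convert h using 1
    apply Subtype.ext
    simp only [AddSubgroupClass.coe_sub]
    refine Derivation.ext fun y => ?_
    simp only [Derivation.sub_apply, Derivation.smul_apply, Derivation.leibniz, hx, smul_eq_mul, two_smul]
    ring
  rw [eq_top_iff]
  rintro ⟨w, hw⟩ -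
  have hw' : w ∈ (W : Set _) := hw
  rw [hW] at hw'
  obtain ⟨f, rfl⟩ := hw'
  have h : ∑ t, (⟨f t • D t, hmem t (f t)⟩ : W) ∈ I := sum_mem fun t _ => key t (f t)
  convert h using 1
  apply Subtype.ext
  simp
end

section
/- The Lie algebra W(1, i_1, …, i_m), with F-basis {e^{a_1 x^{i_1}}⋯e^{a_m x^{i_m}} x^j ∂ : a_1,…,a_m ∈ ℤ, j ∈ ℕ}, is a simple Lie algebra. -/
set_option synthInstance.maxHeartbeats 1000000
set_option maxHeartbeats 1000000


open Polynomial in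
/-- The polynomial coefficient of the exponential monomial with exponent `a`. -/
noncomputable def wittComp {F : Type*} [Field F] {m : ℕ} (a : Fin m → ℤ)
    (f : AddMonoidAlgebra F ((Fin m → ℤ) × ℕ)) : Polynomial F :=
  f.coeff.sum fun p r => if p.1 = a then Polynomial.monomial p.2 r else 0

section
variable {F : Type*} [Field F] {m : ℕ}

lemma wittComp_zero (a : Fin m → ℤ) :
    wittComp a (0 : AddMonoidAlgebra F ((Fin m → ℤ) × ℕ)) = 0 := by
  simp [wittComp]

lemma wittComp_add (a : Fin m → ℤ) (f g : AddMonoidAlgebra F ((Fin m → ℤ) × ℕ)) :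
    wittComp a (f + g) = wittComp a f + wittComp a g := by
  unfold wittComp
  rw [AddMonoidAlgebra.coeff_add, Finsupp.sum_add_index']
  · intro p; simp
  · intro p r s; split_ifs <;> simp

lemma wittComp_single (a b : Fin m → ℤ) (j : ℕ) (r : F) :
    wittComp a (AddMonoidAlgebra.single (b, j) r) =
      if b = a then Polynomial.monomial j r else 0 := by
  unfold wittComp
  rw [AddMonoidAlgebra.coeff_single, Finsupp.sum_single_index] 
  simp

lemma wittComp_coeff (a : Fin m → ℤ) (j : ℕ) (f : AddMonoidAlgebra F ((Fin m → ℤ) × ℕ)) :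
    (wittComp a f).coeff j = f.coeff (a, j) := by
  induction f using AddMonoidAlgebra.induction_linear with
  | zero => simp [wittComp_zero]
  | add f g hf hg => simp [wittComp_add, hf, hg]
  | single p r =>
    obtain ⟨b, k⟩ := p
    rw [wittComp_single, AddMonoidAlgebra.coeff_single, Finsupp.single_apply]
    by_cases h : b = a
    · simp [h, Polynomial.coeff_monomial]
    · simp [h]

/-- `wittComp` as an additive homomorphism. -/
noncomputable def wittCompHom (a : Fin m → ℤ) :
    AddMonoidAlgebra F ((Fin m → ℤ) × ℕ) →+ Polynomial F where
  toFun := wittComp a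
  map_zero' := wittComp_zero a
  map_add' := wittComp_add a

lemma wittComp_shift (a b : Fin m → ℤ) (f : AddMonoidAlgebra F ((Fin m → ℤ) × ℕ)) :
    wittComp a (AddMonoidAlgebra.single (b, 0) (1 : F) * f) = wittComp (a - b) f := by
  induction f using AddMonoidAlgebra.induction_linear with
  | zero => simp [wittComp_zero]
  | add f g hf hg => simp [wittComp_add, mul_add, hf, hg]
  | single p r =>
    obtain ⟨c, k⟩ := p
    rw [AddMonoidAlgebra.single_mul_single, Prod.mk_add_mk, wittComp_single, wittComp_single]
    simp [eq_sub_iff_add_eq, add_comm]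

/-- derivative of the exponent -/
noncomputable def wittQ (F : Type*) [Field F] {m : ℕ} (idx : Fin m → ℕ) (a : Fin m → ℤ) :
    Polynomial F :=
  ∑ s : Fin m, Polynomial.monomial (idx s - 1) ((a s : F) * (idx s : F))

lemma wittQ_zero (idx : Fin m → ℕ) : wittQ F idx 0 = 0 := by simp [wittQ]

lemma wittQ_ne_zero [CharZero F] (idx : Fin m → ℕ) (hpos : ∀ s, 0 < idx s)
    (hmono : StrictMono idx) (a : Fin m → ℤ) (ha : a ≠ 0) : wittQ F idx a ≠ 0 := by
  obtain ⟨s, hs⟩ := Function.ne_iff.mp ha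
  intro h
  have h1 := congrArg (fun p => Polynomial.coeff p (idx s - 1)) h
  simp only [wittQ, Polynomial.finsetSum_coeff, Polynomial.coeff_zero,
    Polynomial.coeff_monomial] at h1
  rw [Finset.sum_eq_single s] at h1
  · have := hpos s
    simp at h1
    rcases h1 with h1 | h1
    · exact hs h1
    · omega
  · intro t _ ht
    rw [if_neg]
    intro h2
    have := hpos s
    have := hpos t
    exact ht (hmono.injective (by omega))
  · simp

lemma wittComp_D (idx : Fin m → ℕ)
    (D : Derivation F (AddMonoidAlgebra F ((Fin m → ℤ) × ℕ))
      (AddMonoidAlgebra F ((Fin m → ℤ) × ℕ)))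
    (hD : ∀ (a : Fin m → ℤ) (j : ℕ),
      D (AddMonoidAlgebra.single (a, j) (1 : F)) =
        (∑ s : Fin m, (a s * (idx s : ℤ)) •
          AddMonoidAlgebra.single (a, j + (idx s - 1)) (1 : F))
        + (j : ℤ) • AddMonoidAlgebra.single (a, j - 1) (1 : F))
    (a : Fin m → ℤ) (f : AddMonoidAlgebra F ((Fin m → ℤ) × ℕ)) :
    wittComp a (D f) = Polynomial.derivative (wittComp a f) + wittQ F idx a * wittComp a f := by
  have hsm : ∀ (r : F) (g : AddMonoidAlgebra F ((Fin m → ℤ) × ℕ)),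
      wittComp a (r • g) = r • wittComp a g := by
    intro r g
    ext j
    simp [wittComp_coeff]
  induction f using AddMonoidAlgebra.induction_linear with
  | zero => simp [wittComp_zero]
  | add f g hf hg => simp only [wittComp_add, map_add, hf, hg]; ring
  | single p r =>
    obtain ⟨c, k⟩ := p
    have h1 : (AddMonoidAlgebra.single (c, k) r : AddMonoidAlgebra F ((Fin m → ℤ) × ℕ))
        = r • AddMonoidAlgebra.single (c, k) (1 : F) := by simp
    rw [h1, D.map_smul, hsm, hsm, hD]
    have h2 : ∀ g, wittComp a g = wittCompHom (F := F) a g := fun _ => rfl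
    rw [h2, map_add, map_sum]
    have hz : ∀ (n : ℤ) (b : Fin m → ℤ) (j : ℕ),
        wittComp a (n • AddMonoidAlgebra.single (b, j) (1 : F)) =
          if b = a then Polynomial.monomial j (n : F) else 0 := by
      intro n b j
      rw [← wittComp_single]
      congr 1
      simp
    simp only [← h2, wittComp_single, hz]
    by_cases h : c = a
    · subst h
      simp only [if_true, Polynomial.derivative_smul, mul_smul_comm, ← smul_add]
      congr 1
      rw [add_comm, Polynomial.derivative_monomial, wittQ, Finset.sum_mul]
      congr 1
      · simp
      · refine Finset.sum_congr rfl fun s _ => ?_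
        rw [Polynomial.monomial_mul_monomial, add_comm]
        simp
    · simp [h]

lemma witt_ker [CharZero F] (idx : Fin m → ℕ) (hpos : ∀ s, 0 < idx s)
    (hmono : StrictMono idx) (a : Fin m → ℤ) (ha : a ≠ 0) (p : Polynomial F)
    (hp : Polynomial.derivative p + wittQ F idx a * p = 0) : p = 0 := by
  by_contra h
  have hq := wittQ_ne_zero (F := F) idx hpos hmono a ha
  have h1 := Polynomial.degree_derivative_lt h
  have h2 : Polynomial.degree p ≤ (wittQ F idx a * p).degree := by
    rw [mul_comm]; exact Polynomial.degree_le_mul_left p hq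
  have h3 : Polynomial.derivative p = -(wittQ F idx a * p) := by
    linear_combination hp
  rw [h3, Polynomial.degree_neg] at h1
  exact absurd h1 (not_lt.mpr h2)

/-- the exponential support -/
def wittSupp (f : AddMonoidAlgebra F ((Fin m → ℤ) × ℕ)) : Set (Fin m → ℤ) :=
  {a | wittComp a f ≠ 0}

lemma wittSupp_finite (f : AddMonoidAlgebra F ((Fin m → ℤ) × ℕ)) : (wittSupp f).Finite := by
  classical
  refine Set.Finite.subset (f.coeff.support.image Prod.fst).finite_toSet ?_
  intro a ha
  obtain ⟨j, hj⟩ := Polynomial.support_nonempty.mpr ha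
  rw [Polynomial.mem_support_iff, wittComp_coeff] at hj
  simp only [Finset.coe_image, Set.mem_image]
  exact ⟨(a, j), by simpa using hj, rfl⟩

lemma witt_ext (f g : AddMonoidAlgebra F ((Fin m → ℤ) × ℕ))
    (h : ∀ a, wittComp a f = wittComp a g) : f = g := by
  apply AddMonoidAlgebra.ext
  ext ⟨a, j⟩
  rw [← wittComp_coeff, ← wittComp_coeff, h]

lemma wittSupp_shift_card (b : Fin m → ℤ) (f : AddMonoidAlgebra F ((Fin m → ℤ) × ℕ)) :
    (wittSupp (AddMonoidAlgebra.single (b, 0) (1 : F) * f)).ncard = (wittSupp f).ncard := by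
  have : wittSupp (AddMonoidAlgebra.single (b, 0) (1 : F) * f) = (fun a => a + b) '' wittSupp f := by
    ext a
    simp only [wittSupp, Set.mem_ofPred_eq, wittComp_shift, Set.mem_image]
    constructor
    · intro h; exact ⟨a - b, h, by simp⟩
    · rintro ⟨c, hc, rfl⟩; simpa using hc
  rw [this, Set.ncard_image_of_injective _ (add_left_injective b)]

lemma witt_D_simple [CharZero F] (idx : Fin m → ℕ) (hpos : ∀ s, 0 < idx s)
    (hmono : StrictMono idx)
    (D : Derivation F (AddMonoidAlgebra F ((Fin m → ℤ) × ℕ))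
      (AddMonoidAlgebra F ((Fin m → ℤ) × ℕ)))
    (hD : ∀ (a : Fin m → ℤ) (j : ℕ),
      D (AddMonoidAlgebra.single (a, j) (1 : F)) =
        (∑ s : Fin m, (a s * (idx s : ℤ)) •
          AddMonoidAlgebra.single (a, j + (idx s - 1)) (1 : F))
        + (j : ℤ) • AddMonoidAlgebra.single (a, j - 1) (1 : F))
    (S : AddMonoidAlgebra F ((Fin m → ℤ) × ℕ) → Prop)
    (hmul : ∀ f g, S f → S (g * f)) (hder : ∀ f, S f → S (D f)) :
    ∀ (n : ℕ) (f : AddMonoidAlgebra F ((Fin m → ℤ) × ℕ)), (wittSupp f).ncard = n →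
      f ≠ 0 → S f → S 1 := by
  intro n
  induction n using Nat.strong_induction_on with
  | _ n ih =>
    have key : ∀ (k : ℕ) (g : AddMonoidAlgebra F ((Fin m → ℤ) × ℕ)),
        (wittComp 0 g).natDegree = k → (wittSupp g).ncard = n → wittComp 0 g ≠ 0 → S g → S 1 := by
      intro k
      induction k using Nat.strong_induction_on with
      | _ k ihk =>
        intro g hk hn h0 hS
        have hsub : wittSupp (D g) ⊆ wittSupp g := by
          intro a ha hz
          apply ha
          rw [wittComp_D idx D hD, hz]; simp
        have hle := Set.ncard_le_ncard hsub (wittSupp_finite g)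
        have hcomp0 : wittComp 0 (D g) = Polynomial.derivative (wittComp 0 g) := by
          rw [wittComp_D idx D hD, wittQ_zero]; simp
        by_cases hz : D g = 0
        · have hc : Polynomial.derivative (wittComp 0 g) = 0 := by
            rw [← hcomp0, hz, wittComp_zero]
          have hC := Polynomial.eq_C_of_derivative_eq_zero hc
          set c := (wittComp 0 g).coeff 0 with hcdef
          have hc0 : c ≠ 0 := by
            intro h; apply h0; rw [hC, h]; simp
          have hg : g = AddMonoidAlgebra.single (0, 0) c := by
            apply witt_ext
            intro a
            rw [wittComp_single]
            by_cases ha : a = 0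
            · subst ha
              rw [if_pos rfl]; exact hC
            · rw [if_neg (Ne.symm ha)]
              apply witt_ker idx hpos hmono a ha
              rw [← wittComp_D idx D hD, hz, wittComp_zero]
          have := hmul g (AddMonoidAlgebra.single (0, 0) c⁻¹) hS
          rw [hg, AddMonoidAlgebra.single_mul_single, inv_mul_cancel₀ hc0] at this
          exact this
        · by_cases hlt : (wittSupp (D g)).ncard < n
          · exact ih _ hlt (D g) rfl hz (hder g hS)
          · have heq : wittSupp (D g) = wittSupp g :=
              Set.eq_of_subset_of_ncard_le hsub (by omega) (wittSupp_finite g)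
            have h0' : wittComp 0 (D g) ≠ 0 := by
              have : (0 : Fin m → ℤ) ∈ wittSupp (D g) := by rw [heq]; exact h0
              exact this
            refine ihk _ ?_ (D g) rfl (by omega) h0' (hder g hS)
            rw [hcomp0, ← hk]
            apply Polynomial.natDegree_derivative_lt
            intro hd
            apply h0'
            rw [hcomp0, Polynomial.derivative_of_natDegree_zero hd]
    intro f hn hf hS
    have : ∃ b, wittComp b f ≠ 0 := by
      by_contra! h
      exact hf (witt_ext f 0 fun a => by rw [h, wittComp_zero])
    obtain ⟨b, hb⟩ := this
    refine key _ (AddMonoidAlgebra.single (-b, 0) (1 : F) * f) rfl ?_ ?_ (hmul _ _ hS)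
    · rw [wittSupp_shift_card, hn]
    · rw [wittComp_shift]; simpa using hb
end

lemma witt_jordan {F A : Type*} [Field F] [CharZero F] [CommRing A] [Algebra F A]
    (D : Derivation F A A) (x : A) (hx : D x = 1) (S : Submodule F A)
    (hbr : ∀ f g, f ∈ S → f * D g - g * D f ∈ S) (f c : A) (hf : f ∈ S) : c * f ∈ S := by
  have T : ∀ u v, (f * D u - u * D f) * D v - v * D (f * D u - u * D f) ∈ S :=
    fun u v => hbr _ v (hbr f u hf)
  have h := S.add_mem (S.sub_mem (T (x * x * c) 1) (S.smul_mem (2 : F) (T (x * c) x)))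
    (T c (x * x))
  have h4 := S.smul_mem (-(4 : F)⁻¹) h
  convert h4 using 1
  have e : ((T' : A) → (2 : F) • T' = 2 * T') := fun T' => by
    rw [two_smul, two_mul]
  rw [e]
  have : ∀ y : A, y = (-4 : F) • (c * f) → c * f = (-(4 : F)⁻¹) • y := by
    rintro y rfl
    rw [smul_smul]; norm_num
  apply this
  have e4 : (-4 : F) • (c * f) = -4 * (c * f) := by
    rw [Algebra.smul_def, map_neg, map_ofNat]
  rw [e4]
  simp only [map_sub, Derivation.leibniz, smul_eq_mul, hx, Derivation.map_one_eq_zero, map_add]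
  ring

/-- The Lie algebra `W(1, i_1, …, i_m)`, with basis
`{e^{a_1 x^{i_1}}⋯e^{a_m x^{i_m}} x^j ∂ : a ∈ ℤ^m, j ∈ ℕ}`, is simple.

Here `R` is the monoid algebra `F[ℤ^m × ℕ]`, `∂` is the derivation `D`
characterized on basis monomials, and `W(1, i_1, …, i_m) = R∂` is the
Lie subalgebra `W` of the `F`-derivations of `R`. -/
theorem generalized_witt_algebra_rank_one_isSimple
    (F : Type*) [Field F] [CharZero F]
    (m : ℕ) (hm : 0 < m)
    (idx : Fin m → ℕ)
    (hpos : ∀ s, 0 < idx s)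
    (hmono : StrictMono idx)
    (D : Derivation F (AddMonoidAlgebra F ((Fin m → ℤ) × ℕ))
      (AddMonoidAlgebra F ((Fin m → ℤ) × ℕ)))
    (hD : ∀ (a : Fin m → ℤ) (j : ℕ),
      D (AddMonoidAlgebra.single (a, j) (1 : F)) =
        (∑ s : Fin m, (a s * (idx s : ℤ)) •
          AddMonoidAlgebra.single (a, j + (idx s - 1)) (1 : F))
        + (j : ℤ) • AddMonoidAlgebra.single (a, j - 1) (1 : F))
    (W : LieSubalgebra F
      (Derivation F (AddMonoidAlgebra F ((Fin m → ℤ) × ℕ))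
        (AddMonoidAlgebra F ((Fin m → ℤ) × ℕ))))
    (hW : (W : Set (Derivation F (AddMonoidAlgebra F ((Fin m → ℤ) × ℕ))
            (AddMonoidAlgebra F ((Fin m → ℤ) × ℕ)))) =
      {d | ∃ f : AddMonoidAlgebra F ((Fin m → ℤ) × ℕ), d = f • D}) :
    LieAlgebra.IsSimple F W := by
  have hx : D (AddMonoidAlgebra.single ((0 : Fin m → ℤ), 1) (1 : F)) = 1 := by
    rw [hD]; simp [AddMonoidAlgebra.one_def]; rfl
  have hmem : ∀ f : AddMonoidAlgebra F ((Fin m → ℤ) × ℕ), f • D ∈ W := by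
    intro f
    have : f • D ∈ (W : Set (Derivation F (AddMonoidAlgebra F ((Fin m → ℤ) × ℕ))
            (AddMonoidAlgebra F ((Fin m → ℤ) × ℕ)))) := by
      rw [hW]; exact ⟨f, rfl⟩
    exact this
  have hsurj : ∀ w : W, ∃ f, w = ⟨f • D, hmem f⟩ := by
    rintro ⟨w, hw⟩
    have : w ∈ (W : Set (Derivation F (AddMonoidAlgebra F ((Fin m → ℤ) × ℕ))
            (AddMonoidAlgebra F ((Fin m → ℤ) × ℕ)))) := hw
    rw [hW] at this
    obtain ⟨f, rfl⟩ := this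
    exact ⟨f, rfl⟩
  have hbr : ∀ f g : AddMonoidAlgebra F ((Fin m → ℤ) × ℕ),
      ⁅(⟨f • D, hmem f⟩ : W), (⟨g • D, hmem g⟩ : W)⁆
        = ⟨(f * D g - g * D f) • D, hmem _⟩ := by
    intro f g
    apply Subtype.ext
    rw [LieSubalgebra.coe_bracket]
    apply Derivation.ext
    intro y
    simp only [Derivation.commutator_apply, Derivation.smul_apply, Derivation.leibniz, smul_eq_mul]
    ring
  constructor
  · intro I
    by_cases hI : I = ⊥
    · exact Or.inl hI
    right
    let S : Submodule F (AddMonoidAlgebra F ((Fin m → ℤ) × ℕ)) :=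
      { carrier := {f | (⟨f • D, hmem f⟩ : W) ∈ I}
        zero_mem' := by
          have : (⟨(0 : AddMonoidAlgebra F ((Fin m → ℤ) × ℕ)) • D, hmem 0⟩ : W) = 0 :=
            Subtype.ext (zero_smul _ D)
          rw [Set.mem_ofPred_eq, this]
          exact I.zero_mem
        add_mem' := by
          intro f g hf hg
          have : (⟨(f + g) • D, hmem _⟩ : W) = ⟨f • D, hmem f⟩ + ⟨g • D, hmem g⟩ :=
            Subtype.ext (add_smul _ _ D)
          rw [Set.mem_ofPred_eq, this]
          exact I.add_mem hf hg
        smul_mem' := by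
          intro r f hf
          have : (⟨(r • f) • D, hmem _⟩ : W) = r • ⟨f • D, hmem f⟩ :=
            Subtype.ext (smul_assoc r f D)
          rw [Set.mem_ofPred_eq, this]
          exact I.smul_mem r hf }
    have hSmem : ∀ f, f ∈ S ↔ (⟨f • D, hmem f⟩ : W) ∈ I := fun f => Iff.rfl
    have hSbr : ∀ f g, f ∈ S → f * D g - g * D f ∈ S := by
      intro f g hf
      rw [hSmem, ← hbr]
      exact lie_mem_left F W I _ _ hf
    have hmul : ∀ f g, f ∈ S → g * f ∈ S := fun f g hf => witt_jordan D _ hx S hSbr f g hf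
    have hder : ∀ f, f ∈ S → D f ∈ S := by
      intro f hf
      have := S.neg_mem (hSbr f 1 hf)
      simpa using this
    obtain ⟨w, hwI, hw0⟩ : ∃ w ∈ I, w ≠ 0 := by
      by_contra! h
      exact hI ((LieSubmodule.eq_bot_iff I).mpr h)
    obtain ⟨f, rfl⟩ := hsurj w
    have hf0 : f ≠ 0 := by
      rintro rfl
      exact hw0 (Subtype.ext (zero_smul _ D))
    have h1 : (1 : AddMonoidAlgebra F ((Fin m → ℤ) × ℕ)) ∈ S :=
      witt_D_simple idx hpos hmono D hD (fun f => f ∈ S) hmul hder _ f rfl hf0 hwI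
    rw [eq_top_iff]
    intro w _
    obtain ⟨g, rfl⟩ := hsurj w
    have := hmul 1 g h1
    rw [mul_one] at this
    exact this
  · intro hab
    have h := hab.trivial (⟨(1 : AddMonoidAlgebra F ((Fin m → ℤ) × ℕ)) • D, hmem 1⟩ : W)
      ⟨(AddMonoidAlgebra.single ((0 : Fin m → ℤ), 1) (1 : F)) • D, hmem _⟩
    rw [hbr] at h
    have h2 := congrArg (fun w : W => (w : Derivation F (AddMonoidAlgebra F ((Fin m → ℤ) × ℕ))
            (AddMonoidAlgebra F ((Fin m → ℤ) × ℕ)))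
              (AddMonoidAlgebra.single ((0 : Fin m → ℤ), 1) (1 : F))) h
    simp [hx] at h2
end

section
/- For every Lie algebra automorphism θ of W⁺(1) there exist scalars α, β ∈ F with α ≠ 0 such that θ(x∂) = α·(x∂) + β·∂. -/
set_option synthInstance.maxHeartbeats 1000000
set_option maxHeartbeats 1000000

open Polynomial in
theorem witt_deg_bound {F : Type*} [Field F] [CharZero F] (p g : F[X]) (c : F)
    (hp : 2 ≤ p.natDegree)
    (h : p * derivative g - g * derivative p = c • g) : g.natDegree ≤ p.natDegree := by
  by_contra hlt
  push Not at hlt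
  obtain ⟨n, hn⟩ : ∃ n, p.natDegree = n + 1 := ⟨p.natDegree - 1, by omega⟩
  obtain ⟨m, hm⟩ : ∃ m, g.natDegree = m + 1 := ⟨g.natDegree - 1, by omega⟩
  have hp0 : p.coeff (n + 1) ≠ 0 := by
    rw [← hn]
    exact leadingCoeff_ne_zero.2 (by rintro rfl; simp at hn)
  have hg0 : g.coeff (m + 1) ≠ 0 := by
    rw [← hm]
    exact leadingCoeff_ne_zero.2 (by rintro rfl; simp at hm)
  have hdp : (derivative p).natDegree ≤ n := (natDegree_derivative_le p).trans (by omega)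
  have hdg : (derivative g).natDegree ≤ m := (natDegree_derivative_le g).trans (by omega)
  have h1 : (p * derivative g).coeff (n + 1 + m) = _ := coeff_mul_add_eq_of_natDegree_le hn.le hdg
  have h2 : (g * derivative p).coeff (m + 1 + n) = _ := coeff_mul_add_eq_of_natDegree_le hm.le hdp
  have h3 : g.coeff (n + 1 + m) = 0 := coeff_eq_zero_of_natDegree_lt (by omega)
  have h4 := congrArg (fun q => q.coeff (n + 1 + m)) h
  simp only [coeff_sub, coeff_smul, h3, smul_zero, h1] at h4
  rw [show n + 1 + m = m + 1 + n by omega, h2, coeff_derivative, coeff_derivative] at h4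
  have h5 : p.coeff (n + 1) * g.coeff (m + 1) * ((m : F) - n) = 0 := by linear_combination h4
  have h6 : (m : F) - n = 0 := by simpa [hp0, hg0] using h5
  have h7 : m = n := by exact_mod_cast sub_eq_zero.1 h6
  omega

open Polynomial in
theorem witt_aux {F : Type*} [Field F] [CharZero F] (T : F[X] →ₗ[F] F[X])
    (hinj : Function.Injective T) (hsurj : Function.Surjective T)
    (hT : ∀ q, T X * derivative (T q) - T q * derivative (T X) = T (X * derivative q - q)) :
    ∃ α β : F, α ≠ 0 ∧ T X = C α * X + C β := by
  have heig : ∀ k : ℕ, T X * derivative (T (X ^ k)) - T (X ^ k) * derivative (T X)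
      = ((k : F) - 1) • T (X ^ k) := by
    intro k
    rw [hT, ← map_smul]
    congr 1
    rcases k with _ | k
    · simp
    · simp [smul_eq_C_mul]; ring
  have hdeg : (T X).natDegree ≤ 1 := by
    by_contra hlt
    have hle : ∀ q, (T q).natDegree ≤ (T X).natDegree := by
      intro q
      induction q using Polynomial.induction_on' with
      | add q r hq hr =>
        rw [map_add]
        exact (natDegree_add_le _ _).trans (max_le hq hr)
      | monomial k a =>
        rw [← smul_X_eq_monomial, map_smul]
        exact (natDegree_smul_le _ _).trans (witt_deg_bound _ _ _ (by omega) (heig k))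
    obtain ⟨q, hq⟩ := hsurj (X ^ ((T X).natDegree + 1))
    have := hle q
    rw [hq, natDegree_X_pow] at this
    omega
  obtain ⟨a, b, hab⟩ := exists_eq_X_add_C_of_natDegree_le_one hdeg
  refine ⟨a, b, ?_, hab⟩
  rintro rfl
  have h0 := heig 0
  rw [hab] at h0
  simp only [pow_zero, map_zero, zero_mul, zero_add, derivative_C, mul_zero, sub_zero,
    Nat.cast_zero, zero_sub, neg_smul, one_smul] at h0
  have hne : T 1 ≠ 0 := fun h => one_ne_zero (hinj (h.trans (map_zero T).symm))
  have hc := congrArg (fun q => q.coeff (T 1).natDegree) h0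
  have hz : (T 1).coeff ((T 1).natDegree + 1) = 0 := coeff_eq_zero_of_natDegree_lt (by omega)
  simp only [coeff_C_mul, coeff_derivative, hz, zero_mul, mul_zero, coeff_neg] at hc
  exact hne (leadingCoeff_eq_zero.1 (neg_eq_zero.1 hc.symm))

/-- For every Lie algebra automorphism `θ` of `W⁺(1)` (the Lie algebra
of all `F`-derivations of `F[x]`) there exist `α, β ∈ F` with `α ≠ 0` such that
`θ(x∂) = α·(x∂) + β·∂`.  Here `∂` is the derivation `d` with `d(x) = 1`. -/
theorem witt_plus_one_automorphism_on_diagonal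
    (F : Type*) [Field F] [CharZero F]
    (d : Derivation F (Polynomial F) (Polynomial F))
    (hd : d (Polynomial.X) = 1)
    (θ : Derivation F (Polynomial F) (Polynomial F) ≃ₗ⁅F⁆
        Derivation F (Polynomial F) (Polynomial F)) :
    ∃ α β : F, α ≠ 0 ∧
      θ ((Polynomial.X : Polynomial F) • d) =
        α • ((Polynomial.X : Polynomial F) • d) + β • d := by
  have hdd : ∀ q : Polynomial F, d q = Polynomial.derivative q := by
    intro q
    have : d = Polynomial.derivative' := Polynomial.derivation_ext (by simp [hd])
    rw [this]; rfl
  have hrep : ∀ D : Derivation F (Polynomial F) (Polynomial F), D = (D Polynomial.X) • d :=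
    fun D => Polynomial.derivation_ext (by simp [hd])
  have hbr : ∀ p q : Polynomial F, ⁅p • d, q • d⁆ =
      (p * Polynomial.derivative q - q * Polynomial.derivative p) • d := by
    intro p q
    apply Polynomial.derivation_ext
    simp [Derivation.commutator_apply, hd, hdd]
  let T : Polynomial F →ₗ[F] Polynomial F :=
    { toFun := fun q => θ (q • d) Polynomial.X
      map_add' := by intro p q; rw [add_smul, map_add]; rfl
      map_smul' := by intro a q; rw [smul_assoc, map_smul]; rfl }
  have hθ : ∀ q : Polynomial F, θ (q • d) = T q • d := fun q => hrep _
  have hsm : ∀ p q : Polynomial F, p • d = q • d → p = q := by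
    intro p q h
    simpa [hd] using congrArg (fun D => D Polynomial.X) h
  obtain ⟨α, β, hα, h⟩ := witt_aux T
    (by
      intro p q h
      apply hsm
      apply θ.injective
      change θ _ = θ _
      rw [hθ, hθ, h])
    (by
      intro q
      obtain ⟨D, hD⟩ := θ.surjective (q • d)
      refine ⟨D Polynomial.X, hsm _ _ ?_⟩
      rw [← hθ, ← hrep]
      exact hD)
    (by
      intro q
      apply hsm
      rw [← hθ, ← hbr, ← hθ, ← hθ, ← LieEquiv.map_lie, hbr]
      simp)
  refine ⟨α, β, hα, ?_⟩
  rw [hθ, h]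
  apply Polynomial.derivation_ext
  simp [hd, Polynomial.smul_eq_C_mul]
end

section
/- The center of the Lie algebra H(n,n) is exactly F·1, the scalar multiples of the identity monomial m(0,0,0,0); in particular, the center is one-dimensional. -/
set_option synthInstance.maxHeartbeats 1000000
set_option maxHeartbeats 1000000

/-- Coefficients of `D f` for an operator acting by a shift formula on monomials. -/
theorem hnn_coeff_formula {F G : Type*} [Field F] [AddCommGroup G]
    (D : AddMonoidAlgebra F G →ₗ[F] AddMonoidAlgebra F G) (α β : G → ℤ) (e : G)
    (hD : ∀ p, D (AddMonoidAlgebra.single p (1 : F)) =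
      (α p) • AddMonoidAlgebra.single p (1 : F) + (β p) • AddMonoidAlgebra.single (p - e) (1 : F))
    (f : AddMonoidAlgebra F G) (q : G) :
    (D f).coeff q = (α q : F) * f.coeff q + (β (q + e) : F) * f.coeff (q + e) := by
  classical
  induction f using AddMonoidAlgebra.induction_linear with
  | zero => simp
  | add f g hf hg =>
    rw [map_add, AddMonoidAlgebra.coeff_add, Finsupp.add_apply, hf, hg,
      AddMonoidAlgebra.coeff_add, Finsupp.add_apply, Finsupp.add_apply]
    ring
  | single p r =>
    have h1 : AddMonoidAlgebra.single p r = r • AddMonoidAlgebra.single p (1 : F) := by simp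
    have h2 : (p - e = q) ↔ (p = q + e) := sub_eq_iff_eq_add
    rw [h1, map_smul, hD, ← Int.cast_smul_eq_zsmul F, ← Int.cast_smul_eq_zsmul F]
    simp only [AddMonoidAlgebra.coeff_smul, AddMonoidAlgebra.coeff_add,
      AddMonoidAlgebra.coeff_single, Finsupp.smul_apply, Finsupp.add_apply,
      Finsupp.single_apply, h2, smul_eq_mul]
    by_cases h3 : p = q <;> by_cases h4 : p = q + e
    · rw [if_pos h3, if_pos h4, ← h4, ← h3]; ring
    · rw [if_pos h3, if_neg h4, ← h3]; ring
    · rw [if_neg h3, if_pos h4, ← h4]; ring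
    · rw [if_neg h3, if_neg h4]; ring

/-- The kernel of such an operator is supported where both weights vanish. -/
theorem hnn_kernel_support {F G : Type*} [Field F] [CharZero F] [AddCommGroup G]
    (D : AddMonoidAlgebra F G →ₗ[F] AddMonoidAlgebra F G) (α β : G → ℤ) (e : G)
    (hD : ∀ p, D (AddMonoidAlgebra.single p (1 : F)) =
      (α p) • AddMonoidAlgebra.single p (1 : F) + (β p) • AddMonoidAlgebra.single (p - e) (1 : F))
    (hα : ∀ p, α (p + e) = α p) (hβ : ∀ p, β (p + e) = β p + 1)
    (f : AddMonoidAlgebra F G) (hf : D f = 0) (p : G) (hp : f.coeff p ≠ 0) :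
    α p = 0 ∧ β p = 0 := by
  have key : ∀ q, (α q : F) * f.coeff q + (β (q + e) : F) * f.coeff (q + e) = 0 := by
    intro q
    rw [← hnn_coeff_formula D α β e hD f q, hf]
    simp
  have h0 : α p = 0 := by
    by_contra hne
    have hA : ∀ m : ℕ, α (p + m • e) = α p ∧ β (p + m • e) = β p + m ∧
        f.coeff (p + m • e) ≠ 0 := by
      intro m
      induction m with
      | zero => simpa using hp
      | succ m ih =>
        obtain ⟨h1, h2, h3⟩ := ih
        rw [succ_nsmul, ← add_assoc]
        refine ⟨by rw [hα, h1], by rw [hβ, h2]; push_cast; ring, ?_⟩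
        intro h4
        have h5 := key (p + m • e)
        rw [h4, mul_zero, add_zero, h1] at h5
        rcases mul_eq_zero.1 h5 with h6 | h6
        · exact hne (by exact_mod_cast h6)
        · exact h3 h6
    have hinj : Function.Injective (fun m : ℕ => p + m • e) := by
      intro m m' h
      have h1 := (hA m).2.1
      have h2 := (hA m').2.1
      simp only at h
      rw [h, h2] at h1
      omega
    refine Set.infinite_of_injective_forall_mem hinj (s := (f.coeff.support : Set G)) ?_
      (Finset.finite_toSet _)
    intro m
    simpa using (hA m).2.2
  refine ⟨h0, ?_⟩
  have h1 := key (p - e)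
  have h2 : α (p - e) = 0 := by rw [← hα (p - e), sub_add_cancel, h0]
  rw [h2, sub_add_cancel] at h1
  simp only [Int.cast_zero, zero_mul, zero_add] at h1
  rcases mul_eq_zero.1 h1 with h6 | h6
  · exact_mod_cast h6
  · exact absurd h6 hp

/-- The center of the generalized Poisson algebra `H(n,n)` is exactly
`F·1`, the scalar multiples of the identity monomial `m(0,0,0,0)`.

Here `F_{n,n}` is the monoid algebra `F[ℤ^{4n}]` with basis monomial
`m(a,i,b,j) = e^{a·x}·x^i·e^{b·y}·y^j` written `AddMonoidAlgebra.single (a,i,b,j) 1`,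
`Dx k` and `Dy k` are the derivations `∂/∂x_k`, `∂/∂y_k`, and the Poisson bracket is
`{f,g} = Σ_k (∂f/∂x_k·∂g/∂y_k − ∂f/∂y_k·∂g/∂x_k)`. -/
theorem generalized_poisson_center_eq_constants
    (F : Type*) [Field F] [CharZero F] (n : ℕ) (hn : 0 < n)
    (Dx Dy : Fin n →
      Derivation F (AddMonoidAlgebra F ((Fin n → ℤ) × (Fin n → ℤ) × (Fin n → ℤ) × (Fin n → ℤ)))
        (AddMonoidAlgebra F ((Fin n → ℤ) × (Fin n → ℤ) × (Fin n → ℤ) × (Fin n → ℤ))))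
    (hDx : ∀ (k : Fin n) (a i b j : Fin n → ℤ),
      Dx k (AddMonoidAlgebra.single (a, i, b, j) (1 : F)) =
        (a k) • AddMonoidAlgebra.single (a, i, b, j) (1 : F)
          + (i k) • AddMonoidAlgebra.single (a, i - Pi.single k 1, b, j) (1 : F))
    (hDy : ∀ (k : Fin n) (a i b j : Fin n → ℤ),
      Dy k (AddMonoidAlgebra.single (a, i, b, j) (1 : F)) =
        (b k) • AddMonoidAlgebra.single (a, i, b, j) (1 : F)
          + (j k) • AddMonoidAlgebra.single (a, i, b, j - Pi.single k 1) (1 : F)) :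
    {f : AddMonoidAlgebra F ((Fin n → ℤ) × (Fin n → ℤ) × (Fin n → ℤ) × (Fin n → ℤ)) |
        ∀ g, (∑ k : Fin n, (Dx k f * Dy k g - Dy k f * Dx k g)) = 0} =
      {f | ∃ c : F,
        f = c • (AddMonoidAlgebra.single (0 : (Fin n → ℤ) × (Fin n → ℤ) × (Fin n → ℤ) × (Fin n → ℤ)) (1 : F))} := by
  ext f
  simp only [Set.mem_setOf_eq]
  constructor
  · intro h
    have hx : ∀ k, Dx k f = 0 := by
      intro k
      have h1 := h (AddMonoidAlgebra.single (0, 0, 0, Pi.single k 1) 1)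
      rw [Finset.sum_eq_single k] at h1
      · rw [hDx, hDy] at h1
        simpa [AddMonoidAlgebra.one_def, ← Prod.zero_eq_mk] using h1
      · intro l _ hl
        rw [hDx, hDy]
        simp [hl]
      · simp
    have hy : ∀ k, Dy k f = 0 := by
      intro k
      have h1 := h (AddMonoidAlgebra.single (0, Pi.single k 1, 0, 0) 1)
      rw [Finset.sum_eq_single k] at h1
      · rw [hDx, hDy] at h1
        simpa [AddMonoidAlgebra.one_def, ← Prod.zero_eq_mk] using h1
      · intro l _ hl
        rw [hDx, hDy]
        simp [hl]
      · simp
    have hsupp : ∀ p, f.coeff p ≠ 0 → p = 0 := by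
      intro p hp
      have h1 := fun k => hnn_kernel_support (Dx k).toLinearMap (fun p => p.1 k)
        (fun p => p.2.1 k) (0, Pi.single k 1, 0, 0)
        (fun p => by
          obtain ⟨a, i, b, j⟩ := p
          simpa using hDx k a i b j) (by simp) (by simp) f (hx k) p hp
      have h2 := fun k => hnn_kernel_support (Dy k).toLinearMap (fun p => p.2.2.1 k)
        (fun p => p.2.2.2 k) (0, 0, 0, Pi.single k 1)
        (fun p => by
          obtain ⟨a, i, b, j⟩ := p
          simpa using hDy k a i b j) (by simp) (by simp) f (hy k) p hp
      obtain ⟨a, i, b, j⟩ := p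
      simp only at h1 h2
      have e1 : a = 0 := funext fun k => (h1 k).1
      have e2 : i = 0 := funext fun k => (h1 k).2
      have e3 : b = 0 := funext fun k => (h2 k).1
      have e4 : j = 0 := funext fun k => (h2 k).2
      rw [e1, e2, e3, e4]
      rfl
    refine ⟨f.coeff 0, ?_⟩
    ext p
    by_cases hp : p = 0
    · subst hp; simp
    · have : f.coeff p = 0 := by
        by_contra h3
        exact hp (hsupp p h3)
      simp [this, hp]
  · rintro ⟨c, rfl⟩ g
    have h1 : (AddMonoidAlgebra.single
      (0 : (Fin n → ℤ) × (Fin n → ℤ) × (Fin n → ℤ) × (Fin n → ℤ)) (1 : F)) = 1 := rfl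
    rw [h1]
    apply Finset.sum_eq_zero
    intro k _
    rw [Derivation.map_smul, Derivation.map_smul, Derivation.map_one_eq_zero,
      Derivation.map_one_eq_zero]
    simp
end

section
/- For every nonzero element l of \overline{H(n,n)}, the Lie ideal of \overline{H(n,n)} generated by l contains a nonzero element that is an F-linear combination of cosets of basis monomials m(a,i,b,j) whose polynomial exponents i_1,…,i_n, j_1,…,j_n are all positive integers. -/
set_option synthInstance.maxHeartbeats 1000000
set_option maxHeartbeats 1000000

namespace GP

open AddMonoidAlgebra

/-- A linear operator acting like a derivative on monomials kills only functions whose support has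
zero exponents in that variable. -/
lemma ker_aux {F G : Type*} [Field F] [CharZero F] [AddCommGroup G]
    (D : AddMonoidAlgebra F G →ₗ[F] AddMonoidAlgebra F G) (α ι : G → ℤ) (e : G)
    (hα : ∀ g, α (g + e) = α g) (hι : ∀ g, ι (g + e) = ι g + 1)
    (hD : ∀ g, D (single g (1 : F)) = α g • single g (1 : F) + ι g • single (g - e) (1 : F))
    (f : AddMonoidAlgebra F G) (hf : D f = 0) (g : G) (hg : f.coeff g ≠ 0) :
    α g = 0 ∧ ι g = 0 := by
  classical
  have key : ∀ (f : AddMonoidAlgebra F G) (g : G),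
      (D f).coeff g = (α g : F) * f.coeff g + ((ι g : F) + 1) * f.coeff (g + e) := by
    intro f g
    induction f using AddMonoidAlgebra.induction_linear with
    | zero => simp
    | add x y hx hy => simp only [map_add, coeff_add, Finsupp.add_apply, hx, hy]; ring
    | single h r =>
      have h1 : single h r = r • single h (1 : F) := by simp
      rw [h1, map_smul, hD, ← Int.cast_smul_eq_zsmul F (α h), ← Int.cast_smul_eq_zsmul F (ι h)]
      simp only [coeff_smul, coeff_add, coeff_single, Finsupp.smul_apply, Finsupp.add_apply,
        Finsupp.single_apply, smul_eq_mul]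
      by_cases h2 : h = g
      · subst h2
        by_cases h3 : h = h + e
        · have := hι h
          rw [← h3] at this
          omega
        · have h4 : h - e ≠ h := fun h5 => h3 (by rw [sub_eq_iff_eq_add] at h5; exact h5)
          simp [h3, h4]; ring
      · by_cases h3 : h = g + e
        · subst h3
          simp [h2, hι]; ring
        · have h4 : h - e ≠ g := fun h5 => h3 (by rw [sub_eq_iff_eq_add] at h5; exact h5)
          simp [h2, h3, h4]
  have key0 : ∀ g, (α g : F) * f.coeff g + ((ι g : F) + 1) * f.coeff (g + e) = 0 := by
    intro g; rw [← key, hf]; simp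
  have ha : ∀ g, f.coeff g ≠ 0 → α g = 0 := by
    by_contra! hcon
    obtain ⟨g, hg, hag⟩ := hcon
    obtain ⟨m, hm, hmax⟩ := Finset.exists_max_image (f.coeff.support.filter (fun g => α g ≠ 0)) ι
      ⟨g, by simp [hg, hag]⟩
    simp only [Finset.mem_filter, Finsupp.mem_support_iff] at hm hmax
    have h0 := key0 m
    have h1 : f.coeff (m + e) ≠ 0 := by
      intro h
      rw [h] at h0
      simp [hm.1, hm.2] at h0
    have := hmax (m + e) ⟨h1, by rw [hα]; exact hm.2⟩
    rw [hι] at this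
    omega
  refine ⟨ha g hg, ?_⟩
  have h0 := key0 (g - e)
  have h1 : α (g - e) = 0 := by rw [← hα, sub_add_cancel]; exact ha g hg
  have h2 : ι g = ι (g - e) + 1 := by rw [← hι, sub_add_cancel]
  rw [h1, sub_add_cancel] at h0
  simp [hg] at h0
  rw [h2]
  exact_mod_cast h0

/-- The index group. -/
abbrev Idx (n : ℕ) := (Fin n → ℤ) × (Fin n → ℤ) × (Fin n → ℤ) × (Fin n → ℤ)

/-- Span of the monomials all of whose polynomial exponents are at least `c`. -/
noncomputable def S (F : Type*) [Field F] (n : ℕ) (c : ℤ) : Submodule F (AddMonoidAlgebra F (Idx n)) :=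
  Submodule.span F {x | ∃ a i b j : Fin n → ℤ, (∀ k, c ≤ i k) ∧ (∀ k, c ≤ j k) ∧
    x = single (a, i, b, j) (1 : F)}

variable {F : Type*} [Field F] {n : ℕ}

lemma S_mono {c d : ℤ} (h : c ≤ d) : S F n d ≤ S F n c := by
  apply Submodule.span_mono
  rintro x ⟨a, i, b, j, hi, hj, rfl⟩
  exact ⟨a, i, b, j, fun k => h.trans (hi k), fun k => h.trans (hj k), rfl⟩

lemma single_mem_S {c : ℤ} {a i b j : Fin n → ℤ} (hi : ∀ k, c ≤ i k) (hj : ∀ k, c ≤ j k) :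
    single (a, i, b, j) (1 : F) ∈ S F n c :=
  Submodule.subset_span ⟨a, i, b, j, hi, hj, rfl⟩

lemma S_mul {c d : ℤ} {f g : AddMonoidAlgebra F (Idx n)} (hf : f ∈ S F n c) (hg : g ∈ S F n d) :
    f * g ∈ S F n (c + d) := by
  have h : S F n c * S F n d ≤ S F n (c + d) := by
    unfold S
    rw [Submodule.span_mul_span]
    apply Submodule.span_mono
    rintro _ ⟨_, ⟨a, i, b, j, hi, hj, rfl⟩, _, ⟨a', i', b', j', hi', hj', rfl⟩, rfl⟩
    refine ⟨a + a', i + i', b + b', j + j', fun k => add_le_add (hi k) (hi' k),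
      fun k => add_le_add (hj k) (hj' k), ?_⟩
    simp [AddMonoidAlgebra.single_mul_single]
  exact h (Submodule.mul_mem_mul hf hg)

lemma S_exists (f : AddMonoidAlgebra F (Idx n)) : ∃ c, f ∈ S F n c := by
  induction f using AddMonoidAlgebra.induction_linear with
  | zero => exact ⟨0, zero_mem _⟩
  | add x y hx hy =>
    obtain ⟨c, hc⟩ := hx
    obtain ⟨d, hd⟩ := hy
    exact ⟨min c d, add_mem (S_mono (min_le_left _ _) hc) (S_mono (min_le_right _ _) hd)⟩
  | single h r =>
    obtain ⟨a, i, b, j⟩ := h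
    have h1 : single (a, i, b, j) r = r • single (a, i, b, j) (1 : F) := by simp
    obtain ⟨c, hc⟩ := (Set.finite_range i).bddBelow
    obtain ⟨d, hd⟩ := (Set.finite_range j).bddBelow
    refine ⟨min c d, ?_⟩
    rw [h1]
    exact Submodule.smul_mem _ _ (single_mem_S
      (fun k => (min_le_left _ _).trans (hc ⟨k, rfl⟩))
      (fun k => (min_le_right _ _).trans (hd ⟨k, rfl⟩)))

lemma S_coeff_zero (hn : 0 < n) {f : AddMonoidAlgebra F (Idx n)} (hf : f ∈ S F n 1) :
    f.coeff 0 = 0 := by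
  unfold S at hf
  induction hf using Submodule.span_induction with
  | mem x hx =>
    obtain ⟨a, i, b, j, hi, hj, rfl⟩ := hx
    rw [coeff_single, Finsupp.single_apply, if_neg]
    intro h
    have h2 := congrFun (congrArg (fun t : Idx n => t.2.1) h) ⟨0, hn⟩
    have := hi ⟨0, hn⟩
    simp at h2
    omega
  | zero => simp
  | add x y _ _ hx hy => simp [hx, hy]
  | smul r x _ hx => simp [hx]

/-- Operators lowering polynomial exponents by at most one. -/
lemma S_map {c : ℤ} (D : AddMonoidAlgebra F (Idx n) →ₗ[F] AddMonoidAlgebra F (Idx n))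
    (hD : ∀ a i b j : Fin n → ℤ, (∀ k, c ≤ i k) → (∀ k, c ≤ j k) →
      D (single (a, i, b, j) (1 : F)) ∈ S F n (c - 1))
    {f : AddMonoidAlgebra F (Idx n)} (hf : f ∈ S F n c) : D f ∈ S F n (c - 1) := by
  have : S F n c ≤ (S F n (c - 1)).comap D := by
    conv_lhs => unfold S
    rw [Submodule.span_le]
    rintro _ ⟨a, i, b, j, hi, hj, rfl⟩
    exact hD a i b j hi hj
  exact this hf

lemma sub_single_le {c : ℤ} {i : Fin n → ℤ} (hi : ∀ k, c ≤ i k) (k k' : Fin n) :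
    c - 1 ≤ (i - Pi.single k 1 : Fin n → ℤ) k' := by
  have := hi k'
  rw [Pi.sub_apply, Pi.single_apply]
  split_ifs <;> omega

end GP

/-- For every nonzero `l` in `H(n,n)bar = H(n,n)/(F·1)`, the Lie ideal
generated by `l` contains a nonzero `F`-linear combination of cosets of basis
monomials `m(a,i,b,j)` whose polynomial exponents `i_1,…,i_n, j_1,…,j_n` are all
positive integers. -/
theorem generalized_poisson_ideal_contains_positive_part
    (F : Type*) [Field F] [CharZero F] (n : ℕ) (hn : 0 < n)
    (Dx Dy : Fin n →
      Derivation F (AddMonoidAlgebra F ((Fin n → ℤ) × (Fin n → ℤ) × (Fin n → ℤ) × (Fin n → ℤ)))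
        (AddMonoidAlgebra F ((Fin n → ℤ) × (Fin n → ℤ) × (Fin n → ℤ) × (Fin n → ℤ))))
    (hDx : ∀ (k : Fin n) (a i b j : Fin n → ℤ),
      Dx k (AddMonoidAlgebra.single (a, i, b, j) (1 : F)) =
        (a k) • AddMonoidAlgebra.single (a, i, b, j) (1 : F)
          + (i k) • AddMonoidAlgebra.single (a, i - Pi.single k 1, b, j) (1 : F))
    (hDy : ∀ (k : Fin n) (a i b j : Fin n → ℤ),
      Dy k (AddMonoidAlgebra.single (a, i, b, j) (1 : F)) =
        (b k) • AddMonoidAlgebra.single (a, i, b, j) (1 : F)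
          + (j k) • AddMonoidAlgebra.single (a, i, b, j - Pi.single k 1) (1 : F))
    (L : Type*) [LieRing L] [LieAlgebra F L]
    (π : AddMonoidAlgebra F ((Fin n → ℤ) × (Fin n → ℤ) × (Fin n → ℤ) × (Fin n → ℤ)) →ₗ[F] L)
    (hsurj : Function.Surjective π)
    (hker : ∀ f, π f = 0 ↔ ∃ c : F,
      f = c • (AddMonoidAlgebra.single (0 : (Fin n → ℤ) × (Fin n → ℤ) × (Fin n → ℤ) × (Fin n → ℤ)) (1 : F)))
    (hbr : ∀ f g, ⁅π f, π g⁆ = π (∑ k : Fin n, (Dx k f * Dy k g - Dy k f * Dx k g)))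
    (l : L) (hl : l ≠ 0) :
    ∃ l₁ ∈ LieSubmodule.lieSpan F L {l}, l₁ ≠ 0 ∧
      l₁ ∈ Submodule.span F
        {x : L | ∃ a i b j : Fin n → ℤ,
          (∀ k, 0 < i k) ∧ (∀ k, 0 < j k) ∧
          x = π (AddMonoidAlgebra.single (a, i, b, j) (1 : F))} := by
  classical
  obtain ⟨f, rfl⟩ := hsurj l
  obtain ⟨c, hc⟩ := GP.S_exists f
  have hDxS : ∀ k (c : ℤ) g, g ∈ GP.S F n c → Dx k g ∈ GP.S F n (c - 1) := by
    intro k c g hg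
    refine GP.S_map (Dx k : _ →ₗ[F] _) (fun a i b j hi hj => ?_) hg
    have h := hDx k a i b j
    simp only [Derivation.coeFn_coe]
    rw [h]
    refine add_mem (zsmul_mem (GP.single_mem_S (fun k => ?_) fun k => ?_) _)
      (zsmul_mem (GP.single_mem_S (GP.sub_single_le hi k) fun k => ?_) _)
    · linarith [hi k]
    · linarith [hj k]
    · linarith [hj k]
  have hDyS : ∀ k (c : ℤ) g, g ∈ GP.S F n c → Dy k g ∈ GP.S F n (c - 1) := by
    intro k c g hg
    refine GP.S_map (Dy k : _ →ₗ[F] _) (fun a i b j hi hj => ?_) hg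
    have h := hDy k a i b j
    simp only [Derivation.coeFn_coe]
    rw [h]
    refine add_mem (zsmul_mem (GP.single_mem_S (fun k => ?_) fun k => ?_) _)
      (zsmul_mem (GP.single_mem_S (fun k => ?_) (GP.sub_single_le hj k)) _)
    · linarith [hi k]
    · linarith [hj k]
    · linarith [hi k]
  set P := ∑ k : Fin n, (Dx k f • Dy k - Dy k f • Dx k) with hP
  have hPa : ∀ g, P g = ∑ k : Fin n, (Dx k f * Dy k g - Dy k f * Dx k g) := by
    intro g
    have h := congrFun (map_sum (Derivation.coeFnAddMonoidHom (R := F)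
      (A := AddMonoidAlgebra F (GP.Idx n)) (M := AddMonoidAlgebra F (GP.Idx n)))
      (fun k : Fin n => Dx k f • Dy k - Dy k f • Dx k) Finset.univ) g
    rw [Finset.sum_apply] at h
    exact h
  have hPS : ∀ g, g ∈ GP.S F n (3 - c) → P g ∈ GP.S F n 1 := by
    intro g hg
    rw [hPa]
    have e : (1 : ℤ) = (c - 1) + ((3 - c) - 1) := by ring
    rw [e]
    exact sum_mem fun k _ => sub_mem (GP.S_mul (hDxS k _ _ hc) (hDyS k _ _ hg))
      (GP.S_mul (hDyS k _ _ hc) (hDxS k _ _ hg))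
  by_cases hex : ∃ g ∈ GP.S F n (3 - c), P g ≠ 0
  · obtain ⟨g, hg, hne⟩ := hex
    have hmem := hPS g hg
    refine ⟨⁅π f, π g⁆, ?_, ?_, ?_⟩
    · exact lie_mem_left F L (LieSubmodule.lieSpan F L {π f}) _ _
        (LieSubmodule.subset_lieSpan (by simp))
    · rw [hbr, ← hPa]
      intro h0
      obtain ⟨r, hr⟩ := (hker _).1 h0
      have := GP.S_coeff_zero hn hmem
      rw [hr] at this
      simp at this
      rw [this, zero_smul] at hr
      exact hne hr
    · rw [hbr, ← hPa]
      have h1 : π (P g) ∈ (GP.S F n 1).map π := Submodule.mem_map_of_mem hmem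
      unfold GP.S at h1
      rw [Submodule.map_span] at h1
      refine Submodule.span_mono ?_ h1
      rintro _ ⟨_, ⟨a, i, b, j, hi, hj, rfl⟩, rfl⟩
      exact ⟨a, i, b, j, fun k => hi k, fun k => hj k, rfl⟩
  · exfalso
    push Not at hex
    -- the Hamiltonian derivation kills every monomial that is nonnegative in its exponents
    have hkill : ∀ i j : Fin n → ℤ, (∀ k, 0 ≤ i k) → (∀ k, 0 ≤ j k) →
        P (AddMonoidAlgebra.single (0, i, 0, j) (1 : F)) = 0 := by
      intro i j hi hj
      let N : Fin n → ℤ := fun _ => 3 - c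
      have hu := hex (AddMonoidAlgebra.single (0, N, 0, N) (1 : F))
        (GP.single_mem_S (fun _ => le_rfl) (fun _ => le_rfl))
      have hv := hex (AddMonoidAlgebra.single (0, N + i, 0, N + j) (1 : F))
        (GP.single_mem_S (fun k => by have := hi k; simp [N, this])
          (fun k => by have := hj k; simp [N, this]))
      have e1 : AddMonoidAlgebra.single ((0, N + i, 0, N + j) : GP.Idx n) (1 : F)
          = AddMonoidAlgebra.single (0, N, 0, N) 1 * AddMonoidAlgebra.single (0, i, 0, j) 1 := by
        simp [AddMonoidAlgebra.single_mul_single]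
      have e2 : AddMonoidAlgebra.single ((0, -N, 0, -N) : GP.Idx n) (1 : F)
          * AddMonoidAlgebra.single (0, N, 0, N) 1 = 1 := by
        simp [AddMonoidAlgebra.single_mul_single, AddMonoidAlgebra.one_def]
        rfl
      rw [e1, Derivation.leibniz, hu, smul_zero, add_zero, smul_eq_mul] at hv
      have := congrArg (fun t => AddMonoidAlgebra.single ((0, -N, 0, -N) : GP.Idx n) (1 : F) * t) hv
      simpa only [← mul_assoc, e2, one_mul, mul_zero] using this
    have hs : ∀ k k' : Fin n, 0 ≤ (Pi.single k 1 : Fin n → ℤ) k' := by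
      intro k k'
      rw [Pi.single_apply]; split_ifs <;> simp
    have h0 : (AddMonoidAlgebra.single (0, 0, 0, 0) (1 : F) : AddMonoidAlgebra F (GP.Idx n)) = 1 :=
      rfl
    have hDy0 : ∀ k, Dy k f = 0 := by
      intro k
      have h := hkill (Pi.single k 1) 0 (hs k) (fun _ => le_rfl)
      rw [hPa, Finset.sum_eq_single k] at h
      · rw [hDx, hDy] at h
        simpa [h0] using h
      · intro k' _ hk
        rw [hDx, hDy]
        simp [Pi.single_apply, hk]
      · simp
    have hDx0 : ∀ k, Dx k f = 0 := by
      intro k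
      have h := hkill 0 (Pi.single k 1) (fun _ => le_rfl) (hs k)
      rw [hPa, Finset.sum_eq_single k] at h
      · rw [hDx, hDy] at h
        simpa [h0] using h
      · intro k' _ hk
        rw [hDx, hDy]
        simp [Pi.single_apply, hk]
      · simp
    have hx := fun k => GP.ker_aux (Dx k : _ →ₗ[F] _) (fun t : GP.Idx n => t.1 k)
      (fun t => t.2.1 k) (0, Pi.single k 1, 0, 0) (by simp) (by simp)
      (by rintro ⟨a, i, b, j⟩; simpa using hDx k a i b j) f (hDx0 k)
    have hy := fun k => GP.ker_aux (Dy k : _ →ₗ[F] _) (fun t : GP.Idx n => t.2.2.1 k)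
      (fun t => t.2.2.2 k) (0, 0, 0, Pi.single k 1) (by simp) (by simp)
      (by rintro ⟨a, i, b, j⟩; simpa using hDy k a i b j) f (hDy0 k)
    apply hl
    rw [hker]
    refine ⟨f.coeff 0, ?_⟩
    ext t
    by_cases ht : t = 0
    · subst ht; simp
    · have : f.coeff t = 0 := by
        by_contra hne
        apply ht
        obtain ⟨a, i, b, j⟩ := t
        have hx' := fun k => hx k _ hne
        have hy' := fun k => hy k _ hne
        refine Prod.ext (funext fun k => (hx' k).1) (Prod.ext (funext fun k => (hx' k).2)
          (Prod.ext (funext fun k => (hy' k).1) (funext fun k => (hy' k).2)))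
      rw [this]
      simp [Finsupp.single_apply, Ne.symm ht]
end

section
/- The quotient Lie algebra \overline{H(n,0)} = H(n,0)/(F·e_0) is a simple Lie algebra. -/
set_option synthInstance.maxHeartbeats 1000000
set_option maxHeartbeats 1000000

/-- the symplectic form -/
def sympW {n : ℕ} (u v : (Fin n → ℤ) × (Fin n → ℤ)) : ℤ :=
  ∑ k : Fin n, (u.1 k * v.2 k - v.1 k * u.2 k)

lemma sympW_add_left {n : ℕ} (a b v : (Fin n → ℤ) × (Fin n → ℤ)) :
    sympW (a + b) v = sympW a v + sympW b v := by
  simp only [sympW, ← Finset.sum_add_distrib, Prod.fst_add, Prod.snd_add, Pi.add_apply]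
  exact Finset.sum_congr rfl fun k _ => by ring

lemma sympW_swap {n : ℕ} (a b : (Fin n → ℤ) × (Fin n → ℤ)) :
    sympW a b = - sympW b a := by
  simp only [sympW, ← Finset.sum_neg_distrib]
  exact Finset.sum_congr rfl fun k _ => by ring

lemma sympW_add_right {n : ℕ} (v a b : (Fin n → ℤ) × (Fin n → ℤ)) :
    sympW v (a + b) = sympW v a + sympW v b := by
  rw [sympW_swap, sympW_add_left, sympW_swap v a, sympW_swap v b]; ring

lemma sympW_self {n : ℕ} (a : (Fin n → ℤ) × (Fin n → ℤ)) : sympW a a = 0 := by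
  simp [sympW]

lemma sympW_zero_right {n : ℕ} (a : (Fin n → ℤ) × (Fin n → ℤ)) : sympW a 0 = 0 := by
  simp [sympW]

lemma sympW_sub_right {n : ℕ} (v a b : (Fin n → ℤ) × (Fin n → ℤ)) :
    sympW v (a - b) = sympW v a - sympW v b := by
  have h := sympW_add_right v (a - b) b
  rw [sub_add_cancel] at h; omega

lemma sympW_nondeg {n : ℕ} {u : (Fin n → ℤ) × (Fin n → ℤ)} (hu : u ≠ 0) :
    ∃ v, sympW v u ≠ 0 := by
  by_contra! h
  apply hu
  ext k
  · have := h (0, Pi.single k 1)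
    simpa [sympW, Pi.single_apply] using this
  · have := h (Pi.single k 1, 0)
    simpa [sympW, Pi.single_apply] using this

lemma sympW_nondeg2 {n : ℕ} {p q : (Fin n → ℤ) × (Fin n → ℤ)} (hp : p ≠ 0) (hq : q ≠ 0) :
    ∃ v, sympW v p ≠ 0 ∧ sympW v q ≠ 0 := by
  obtain ⟨a, ha⟩ := sympW_nondeg hp
  obtain ⟨b, hb⟩ := sympW_nondeg hq
  by_cases h1 : sympW a q = 0
  · by_cases h2 : sympW b p = 0
    · refine ⟨a + b, ?_, ?_⟩ <;> rw [sympW_add_left] <;> omega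
    · exact ⟨b, h2, hb⟩
  · exact ⟨a, ha, h1⟩

lemma sympW_choose {n : ℕ} {a b : (Fin n → ℤ) × (Fin n → ℤ)} (hb : b ≠ 0) (hab : a ≠ b) :
    ∃ v, sympW v b ≠ 0 ∧ sympW (a + v) (b + v) ≠ 0 := by
  obtain ⟨w, h1, h2⟩ := sympW_nondeg2 hb (sub_ne_zero.2 hab.symm)
  rw [sympW_sub_right] at h2
  have h3 := sympW_swap a w
  by_cases h : sympW (a + w) (b + w) = 0
  · refine ⟨w + w, ?_, ?_⟩ <;>
      simp only [sympW_add_left, sympW_add_right, sympW_self] at * <;> omega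
  · exact ⟨w, h1, h⟩

/-- the adjoint action of a basis vector -/
noncomputable def sympD (F : Type*) [Field F] {n : ℕ} (v : (Fin n → ℤ) × (Fin n → ℤ)) :
    (((Fin n → ℤ) × (Fin n → ℤ)) →₀ F) →ₗ[F] (((Fin n → ℤ) × (Fin n → ℤ)) →₀ F) :=
  Finsupp.linearCombination F fun u => Finsupp.single (v + u) (sympW v u : F)

lemma sympD_apply (F : Type*) [Field F] {n : ℕ} (v : (Fin n → ℤ) × (Fin n → ℤ))
    (f : ((Fin n → ℤ) × (Fin n → ℤ)) →₀ F) (w : (Fin n → ℤ) × (Fin n → ℤ)) :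
    sympD F v f w = (sympW v w : F) * f (w - v) := by
  induction f using Finsupp.induction_linear with
  | zero => simp
  | add f g hf hg => simp [hf, hg, mul_add]
  | single u c =>
    simp only [sympD, Finsupp.linearCombination_single, Finsupp.smul_apply, Finsupp.single_apply,
      smul_eq_mul, eq_sub_iff_add_eq, add_comm u v]
    split_ifs with h
    · subst h
      rw [sympW_add_right, sympW_self, zero_add, mul_comm]
    · simp

lemma sympD_map {F : Type*} [Field F] {n : ℕ}
    {L : Type*} [LieRing L] [LieAlgebra F L]
    (π : (((Fin n → ℤ) × (Fin n → ℤ)) →₀ F) →ₗ[F] L)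
    (hbr : ∀ u v : (Fin n → ℤ) × (Fin n → ℤ),
      ⁅π (Finsupp.single u (1 : F)), π (Finsupp.single v (1 : F))⁆ =
        sympW u v • π (Finsupp.single (u + v) (1 : F)))
    (v : (Fin n → ℤ) × (Fin n → ℤ)) (f : ((Fin n → ℤ) × (Fin n → ℤ)) →₀ F) :
    π (sympD F v f) = ⁅π (Finsupp.single v (1 : F)), π f⁆ := by
  induction f using Finsupp.induction_linear with
  | zero => simp
  | add f g hf hg => simp [hf, hg]
  | single u c =>
    have h1 : Finsupp.single u c = c • Finsupp.single u (1 : F) := by simp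
    have h2 : Finsupp.single (v + u) (sympW v u : F)
      = (sympW v u) • Finsupp.single (v + u) (1 : F) := by simp
    rw [sympD, Finsupp.linearCombination_single, h1, map_smul, map_smul, lie_smul, hbr, h2,
      map_zsmul]

lemma sympI_single {F : Type*} [Field F] [CharZero F] {n : ℕ}
    {L : Type*} [LieRing L] [LieAlgebra F L]
    (π : (((Fin n → ℤ) × (Fin n → ℤ)) →₀ F) →ₗ[F] L)
    (hbr : ∀ u v : (Fin n → ℤ) × (Fin n → ℤ),
      ⁅π (Finsupp.single u (1 : F)), π (Finsupp.single v (1 : F))⁆ =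
        sympW u v • π (Finsupp.single (u + v) (1 : F)))
    (I : LieIdeal F L) (k : ℕ) : ∀ f : ((Fin n → ℤ) × (Fin n → ℤ)) →₀ F,
      f.support.card = k → f 0 = 0 → f ≠ 0 → π f ∈ I →
      ∃ u ≠ 0, π (Finsupp.single u (1 : F)) ∈ I := by
  induction k using Nat.strong_induction_on with
  | _ k ih =>
  intro f hk h0 hf hI
  obtain ⟨b, hb⟩ := Finsupp.support_nonempty_iff.2 hf
  have hb0 : b ≠ 0 := by
    rintro rfl
    exact (Finsupp.mem_support_iff.1 hb) h0
  by_cases hall : ∀ a ∈ f.support, a = b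
  · refine ⟨b, hb0, ?_⟩
    have hfb : f = Finsupp.single b (f b) := by
      ext a
      rw [Finsupp.single_apply]
      split_ifs with h
      · rw [h]
      · by_contra h'
        exact h (hall a (Finsupp.mem_support_iff.2 h')).symm
    have h1 : Finsupp.single b (1 : F) = (f b)⁻¹ • f := by
      conv_rhs => rw [hfb]
      simp [inv_mul_cancel₀ (Finsupp.mem_support_iff.1 hb)]
    rw [h1, map_smul]
    exact I.smul_mem _ hI
  · push Not at hall
    obtain ⟨a, ha, hab⟩ := hall
    obtain ⟨v, hv1, hv2⟩ := sympW_choose hb0 hab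
    have happ : ∀ w, sympD F (a + v) (sympD F v f) w
        = (sympW (a + v) w : F) * ((sympW v (w - (a + v)) : F) * f (w - (a + v) - v)) := by
      intro w
      rw [sympD_apply, sympD_apply]
    refine ih _ ?_ (sympD F (a + v) (sympD F v f)) rfl ?_ ?_ ?_
    · have hsub : (sympD F (a + v) (sympD F v f)).support ⊆
          (f.support.erase a).image (fun u => u + v + (a + v)) := by
        intro w hw
        rw [Finsupp.mem_support_iff, happ] at hw
        rw [Finset.mem_image]
        refine ⟨w - (a + v) - v, ?_, by abel⟩
        rw [Finset.mem_erase]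
        refine ⟨?_, ?_⟩
        · intro h
          apply hw
          have : w = (a + v) + (a + v) := by
            rw [sub_eq_iff_eq_add, sub_eq_iff_eq_add] at h
            exact h
          rw [this, sympW_add_right, sympW_self]
          simp
        · rw [Finsupp.mem_support_iff]
          intro h
          apply hw
          rw [h]; simp
      calc _ ≤ _ := Finset.card_le_card hsub
        _ ≤ _ := Finset.card_image_le
        _ < _ := Finset.card_erase_lt_of_mem ha
        _ = k := hk
    · rw [happ, sympW_zero_right]; simp
    · intro h
      have h2 := happ (b + v + (a + v))
      rw [h, add_sub_cancel_right, add_sub_cancel_right, sympW_add_right (a + v) (b + v),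
        sympW_self, add_zero, sympW_add_right v b, sympW_self, add_zero] at h2
      have h3 : (sympW (a + v) (b + v) : F) ≠ 0 := Int.cast_ne_zero.2 hv2
      have h4 : (sympW v b : F) ≠ 0 := Int.cast_ne_zero.2 hv1
      exact mul_ne_zero h3 (mul_ne_zero h4 (Finsupp.mem_support_iff.1 hb)) h2.symm
    · rw [sympD_map π hbr, sympD_map π hbr]
      exact lie_mem_right F L I _ _ (lie_mem_right F L I _ _ hI)

lemma sympI_step {F : Type*} [Field F] [CharZero F] {n : ℕ}
    {L : Type*} [LieRing L] [LieAlgebra F L]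
    (π : (((Fin n → ℤ) × (Fin n → ℤ)) →₀ F) →ₗ[F] L)
    (hbr : ∀ u v : (Fin n → ℤ) × (Fin n → ℤ),
      ⁅π (Finsupp.single u (1 : F)), π (Finsupp.single v (1 : F))⁆ =
        sympW u v • π (Finsupp.single (u + v) (1 : F)))
    (I : LieIdeal F L) (u w : (Fin n → ℤ) × (Fin n → ℤ)) (h : sympW w u ≠ 0)
    (hu : π (Finsupp.single u (1 : F)) ∈ I) : π (Finsupp.single w (1 : F)) ∈ I := by
  have h1 := lie_mem_right F L I (π (Finsupp.single (w - u) (1 : F))) _ hu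
  have h2 : sympW (w - u) u = sympW w u := by
    have := sympW_add_left (w - u) u u
    rw [sub_add_cancel, sympW_self] at this
    omega
  rw [hbr, sub_add_cancel, h2, ← Int.cast_smul_eq_zsmul F] at h1
  have h3 : (sympW w u : F) ≠ 0 := Int.cast_ne_zero.2 h
  have h4 := I.smul_mem (sympW w u : F)⁻¹ h1
  rwa [smul_smul, inv_mul_cancel₀ h3, one_smul] at h4

/-- The quotient Lie algebra `H(n,0)bar = H(n,0)/(F·e_0)` is simple.

`H(n,0)` has basis `{e_u : u ∈ ℤ^{2n}}` with `[e_u, e_v] = ω(u,v)·e_{u+v}`, where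
`ω((a,b),(c,d)) = Σ_k (a_k d_k − c_k b_k)` is the standard symplectic form on
`ℤ^{2n}`; the quotient by the center `F·e_0` is presented by an `F`-linear
surjection `π` onto a Lie algebra `L` with kernel `F·e_0` carrying the bracket of
basis vectors to the Lie bracket of `L`. -/
theorem exponential_poisson_quotient_isSimple
    (F : Type*) [Field F] [CharZero F] (n : ℕ) (hn : 0 < n)
    (L : Type*) [LieRing L] [LieAlgebra F L]
    (π : (((Fin n → ℤ) × (Fin n → ℤ)) →₀ F) →ₗ[F] L)
    (hsurj : Function.Surjective π)
    (hker : ∀ f, π f = 0 ↔ ∃ c : F, f = Finsupp.single (0 : (Fin n → ℤ) × (Fin n → ℤ)) c)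
    (hbr : ∀ u v : (Fin n → ℤ) × (Fin n → ℤ),
      ⁅π (Finsupp.single u (1 : F)), π (Finsupp.single v (1 : F))⁆ =
        (∑ k : Fin n, (u.1 k * v.2 k - v.1 k * u.2 k)) • π (Finsupp.single (u + v) (1 : F))) :
    LieAlgebra.IsSimple F L := by
  change ∀ u v : (Fin n → ℤ) × (Fin n → ℤ),
      ⁅π (Finsupp.single u (1 : F)), π (Finsupp.single v (1 : F))⁆ =
        sympW u v • π (Finsupp.single (u + v) (1 : F)) at hbr
  have hz : ∀ c : F, π (Finsupp.single 0 c) = 0 := fun c => (hker _).2 ⟨c, rfl⟩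
  have hE : ∀ u ≠ 0, π (Finsupp.single u (1 : F)) ≠ 0 := by
    intro u hu h
    obtain ⟨c, hc⟩ := (hker _).1 h
    have := DFunLike.congr_fun hc u
    simp [hu] at this
  refine ⟨?_, ?_⟩
  · intro I
    by_cases hI : I = ⊥
    · exact Or.inl hI
    right
    obtain ⟨x, hxI, hx⟩ : ∃ x ∈ I, x ≠ 0 := by
      by_contra! h
      exact hI ((LieSubmodule.eq_bot_iff I).2 h)
    obtain ⟨f, rfl⟩ := hsurj x
    have hsplit : π (f.erase 0) = π f := by
      conv_rhs => rw [← Finsupp.single_add_erase 0 f]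
      rw [map_add, hz, zero_add]
    obtain ⟨u, hu0, hu⟩ := sympI_single π hbr I _ (f.erase 0) rfl (by simp)
      (by intro h; rw [h, map_zero] at hsplit; exact hx hsplit.symm) (by rwa [hsplit])
    have hall : ∀ w, π (Finsupp.single w (1 : F)) ∈ I := by
      intro w
      by_cases hw : w = 0
      · rw [hw, hz]; exact I.zero_mem
      obtain ⟨m, hm1, hm2⟩ := sympW_nondeg2 hu0 hw
      refine sympI_step π hbr I m w ?_ (sympI_step π hbr I u m hm1 hu)
      rw [sympW_swap]; omega
    rw [eq_top_iff]
    rintro y -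
    obtain ⟨g, rfl⟩ := hsurj y
    induction g using Finsupp.induction_linear with
    | zero => simp
    | add f g hf hg => rw [map_add]; exact I.add_mem hf hg
    | single u c =>
      have h1 : Finsupp.single u c = c • Finsupp.single u (1 : F) := by simp
      rw [h1, map_smul]
      exact I.smul_mem _ (hall u)
  · intro hab
    have hu : ((fun _ => 1, 0) : (Fin n → ℤ) × (Fin n → ℤ)) ≠ 0 := by
      intro h
      have := congrFun (congrArg Prod.fst h) ⟨0, hn⟩
      simp at this
    obtain ⟨v, hv⟩ := sympW_nondeg hu
    have h := hbr v (fun _ => 1, 0)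
    rw [LieModule.IsTrivial.trivial, eq_comm, ← Int.cast_smul_eq_zsmul F, smul_eq_zero] at h
    rcases h with h | h
    · exact hv (Int.cast_eq_zero.1 h)
    · refine hE _ ?_ h
      intro h0
      apply hv
      have := sympW_add_right v v (fun _ => 1, 0)
      rw [h0, sympW_zero_right, sympW_self] at this
      omega
end

section
/- The Lie algebras \overline{H(n,0)} and \overline{H(n)} are not isomorphic as Lie algebras over F. -/
set_option synthInstance.maxHeartbeats 1000000
set_option maxHeartbeats 1000000

open MvPolynomial

/-- A partial derivative is locally nilpotent. -/
lemma pderiv_locally_nilpotent {F σ : Type*} [Field F] (i : σ) (p : MvPolynomial σ F) :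
    ∃ k : ℕ, (pderiv i)^[k] p = 0 := by
  classical
  have hz : ∀ m : ℕ, (pderiv i)^[m] (0 : MvPolynomial σ F) = 0 := fun m =>
    iterate_map_zero (pderiv i) m
  have hadd : ∀ (m : ℕ) (p q : MvPolynomial σ F),
      (pderiv i)^[m] (p + q) = (pderiv i)^[m] p + (pderiv i)^[m] q := fun m p q =>
    iterate_map_add (pderiv i) m p q
  induction p using MvPolynomial.induction_on' with
  | monomial s a =>
    have key : ∀ (m : ℕ) (s : σ →₀ ℕ) (a : F), s i ≤ m →
        (pderiv i)^[m + 1] (monomial s a) = 0 := by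
      intro m
      induction m with
      | zero =>
        intro s a h
        have h0 : s i = 0 := by omega
        simp [pderiv_monomial, h0]
      | succ m ih =>
        intro s a h
        rw [Function.iterate_succ_apply, pderiv_monomial]
        apply ih
        simp
        omega
    exact ⟨_, key _ s a le_rfl⟩
  | add p q hp hq =>
    obtain ⟨a, ha⟩ := hp
    obtain ⟨b, hb⟩ := hq
    refine ⟨a + b, ?_⟩
    rw [hadd]
    have h1 : (pderiv i)^[a + b] p = 0 := by
      rw [add_comm, Function.iterate_add_apply, ha, hz]
    have h2 : (pderiv i)^[a + b] q = 0 := by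
      rw [Function.iterate_add_apply, hb, hz]
    rw [h1, h2, add_zero]

/-- Brackets of spans of graded elements. -/
lemma lie_mem_span_graded {F G L : Type*} [Field F] [AddCommGroup G] [LieRing L] [LieAlgebra F L]
    (e : G → L) (w : G → G → ℤ) (hbr : ∀ u v, ⁅e u, e v⁆ = w u v • e (u + v))
    (s t r : Set G) (hr : ∀ a ∈ s, ∀ b ∈ t, a + b ∈ r) {x y : L}
    (hx : x ∈ Submodule.span F (e '' s)) (hy : y ∈ Submodule.span F (e '' t)) :
    ⁅x, y⁆ ∈ Submodule.span F (e '' r) := by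
  induction hx using Submodule.span_induction with
  | mem x hx =>
    obtain ⟨a, ha, rfl⟩ := hx
    induction hy using Submodule.span_induction with
    | mem y hy =>
      obtain ⟨b, hb, rfl⟩ := hy
      rw [hbr]
      have hm : e (a + b) ∈ Submodule.span F (e '' r) :=
        Submodule.subset_span ⟨_, hr a ha b hb, rfl⟩
      exact zsmul_mem hm _
    | zero => simp
    | add y z _ _ h1 h2 => rw [lie_add]; exact add_mem h1 h2
    | smul c y _ h => rw [lie_smul]; exact Submodule.smul_mem _ _ h
  | zero => simp
  | add y z _ _ h1 h2 => rw [add_lie]; exact add_mem h1 h2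
  | smul c y _ h => rw [smul_lie]; exact Submodule.smul_mem _ _ h

/-- The iterated bracket with an element with leading term `a • e u` keeps a leading term. -/
lemma leading_term_iterate {F G L Λ : Type*} [Field F] [CharZero F] [AddCommGroup G]
    [LieRing L] [LieAlgebra F L]
    [AddCommGroup Λ] [LinearOrder Λ] [IsOrderedAddMonoid Λ] (l : G →+ Λ)
    (e : G → L) (w : G → G → ℤ) (hbr : ∀ u v, ⁅e u, e v⁆ = w u v • e (u + v))
    (u v : G) (hw : ∀ k : ℕ, w u (k • u + v) ≠ 0) (a : F) (ha : a ≠ 0) (x : L)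
    (hx : x ∈ Submodule.span F (e '' {z | l z < l u})) (k : ℕ) :
    ∃ c : F, c ≠ 0 ∧ ∃ y ∈ Submodule.span F (e '' {z | l z < l (k • u + v)}),
      (fun z => ⁅a • e u + x, z⁆)^[k] (e v) = c • e (k • u + v) + y := by
  induction k with
  | zero => exact ⟨1, one_ne_zero, 0, zero_mem _, by simp⟩
  | succ k ih =>
    obtain ⟨c, hc, y, hy, h⟩ := ih
    have hs : u + (k • u + v) = (k + 1) • u + v := by rw [succ_nsmul]; abel
    refine ⟨a * c * (w u (k • u + v) : F),
      mul_ne_zero (mul_ne_zero ha hc) (Int.cast_ne_zero.mpr (hw k)),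
      ⁅a • e u, y⁆ + ⁅x, c • e (k • u + v) + y⁆, add_mem ?_ ?_, ?_⟩
    · refine lie_mem_span_graded e w hbr {u} _ _ ?_
        (Submodule.smul_mem _ _ (Submodule.subset_span ⟨u, rfl, rfl⟩)) hy
      rintro _ rfl b hb
      simp only [Set.mem_ofPred_eq] at hb ⊢
      rw [← hs, map_add, map_add l _ (k • _ + v)]
      exact add_lt_add_right hb _
    · refine lie_mem_span_graded e w hbr _ {z | l z ≤ l (k • u + v)} _ ?_ hx
        (add_mem (Submodule.smul_mem _ _ (Submodule.subset_span ⟨_, le_refl (l _), rfl⟩))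
          (Submodule.span_mono (Set.image_mono fun z hz => le_of_lt hz) hy))
      intro p hp b hb
      simp only [Set.mem_ofPred_eq] at hp hb ⊢
      rw [← hs, map_add, map_add l _ (k • _ + v)]
      exact add_lt_add_of_lt_of_le hp hb
    · rw [Function.iterate_succ_apply', h]
      simp only [add_lie, lie_add, smul_lie, lie_smul, hbr, hs]
      rw [← Int.cast_smul_eq_zsmul F]
      simp only [smul_add, smul_smul]
      rw [mul_comm a c, ← mul_assoc]
      abel

/-- The Lie algebras `H(n,0)bar` and `H(n)bar` are not isomorphic
as Lie algebras over `F`.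

`H(n,0)bar` is presented as a Lie algebra `L1` with an `F`-linear surjection `π1`
from the span of `{e_u : u ∈ ℤ^{2n}}` with kernel `F·e_0` and bracket
`[e_u, e_v] = ω(u,v)·e_{u+v}`; the Poisson Lie algebra `H(n)bar` is presented as a
Lie algebra `L2` with an `F`-linear surjection `π2` from `F[x_1,…,x_n,y_1,…,y_n]`
with kernel the constants and bracket the Poisson bracket. -/
theorem exponential_poisson_not_isomorphic_to_poisson
    (F : Type*) [Field F] [CharZero F] (n : ℕ) (hn : 0 < n)
    (L1 : Type*) [LieRing L1] [LieAlgebra F L1]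
    (π1 : (((Fin n → ℤ) × (Fin n → ℤ)) →₀ F) →ₗ[F] L1)
    (hsurj1 : Function.Surjective π1)
    (hker1 : ∀ f, π1 f = 0 ↔ ∃ c : F, f = Finsupp.single (0 : (Fin n → ℤ) × (Fin n → ℤ)) c)
    (hbr1 : ∀ u v : (Fin n → ℤ) × (Fin n → ℤ),
      ⁅π1 (Finsupp.single u (1 : F)), π1 (Finsupp.single v (1 : F))⁆ =
        (∑ k : Fin n, (u.1 k * v.2 k - v.1 k * u.2 k)) • π1 (Finsupp.single (u + v) (1 : F)))
    (L2 : Type*) [LieRing L2] [LieAlgebra F L2]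
    (π2 : MvPolynomial (Fin n ⊕ Fin n) F →ₗ[F] L2)
    (hsurj2 : Function.Surjective π2)
    (hker2 : ∀ f, π2 f = 0 ↔ ∃ c : F, f = MvPolynomial.C c)
    (hbr2 : ∀ f g, ⁅π2 f, π2 g⁆ =
      π2 (∑ k : Fin n,
        (pderiv (Sum.inl k) f * pderiv (Sum.inr k) g
          - pderiv (Sum.inr k) f * pderiv (Sum.inl k) g))) :
    IsEmpty (L1 ≃ₗ⁅F⁆ L2) := by
  classical
  refine ⟨fun φ => ?_⟩
  let G := (Fin n → ℤ) × (Fin n → ℤ)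
  let l : G →+ Lex (Lex (Fin n → ℤ) × Lex (Fin n → ℤ)) :=
    { toFun := fun u => toLex (toLex u.1, toLex u.2)
      map_zero' := rfl
      map_add' := fun _ _ => rfl }
  have hl : Function.Injective l := by
    intro p q h
    have h' := toLex.injective h
    rw [Prod.mk.injEq] at h'
    exact Prod.ext (toLex.injective h'.1) (toLex.injective h'.2)
  let e : G → L1 := fun u => π1 (Finsupp.single u (1 : F))
  let w : G → G → ℤ := fun u v => ∑ k : Fin n, (u.1 k * v.2 k - v.1 k * u.2 k)
  have hspan : ∀ (s : Set G), Submodule.span F (e '' s) = (Finsupp.supported F F s).map π1 := by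
    intro s
    rw [Finsupp.supported_eq_span_single, Submodule.map_span, Set.image_image]
  let k0 : Fin n := ⟨0, hn⟩
  -- the locally ad-nilpotent element `x_1` of `L2`
  have hX : ∀ g, ⁅π2 (X (Sum.inl k0)), π2 g⁆ = π2 (pderiv (Sum.inr k0) g) := by
    intro g
    rw [hbr2]
    congr 1
    simp [pderiv_X, Pi.single_apply, Finset.sum_ite_eq]
  have hXit : ∀ (k : ℕ) g, (fun z => ⁅π2 (X (Sum.inl k0)), z⁆)^[k] (π2 g)
      = π2 ((pderiv (Sum.inr k0))^[k] g) := by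
    intro k
    induction k with
    | zero => intro g; rfl
    | succ k ih => intro g; rw [Function.iterate_succ_apply, hX, ih, Function.iterate_succ_apply]
  have hXnil : ∀ y : L2, ∃ k : ℕ, (fun z => ⁅π2 (X (Sum.inl k0)), z⁆)^[k] y = 0 := by
    intro y
    obtain ⟨g, rfl⟩ := hsurj2 y
    obtain ⟨k, hk⟩ := pderiv_locally_nilpotent (Sum.inr k0) g
    exact ⟨k, by rw [hXit, hk, map_zero]⟩
  have hXne : π2 (X (Sum.inl k0)) ≠ 0 := by
    intro h
    obtain ⟨c, hc⟩ := (hker2 _).1 h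
    have := congrArg (pderiv (Sum.inl k0)) hc
    simp at this
  -- transport to `L1`
  obtain ⟨x, hx⟩ : ∃ x, φ x = π2 (X (Sum.inl k0)) := ⟨φ.symm _, φ.apply_symm_apply _⟩
  have hxne : x ≠ 0 := by
    rintro rfl
    exact hXne (by rw [← hx, map_zero])
  have hxit : ∀ (k : ℕ) z, φ ((fun z => ⁅x, z⁆)^[k] z) =
      (fun z => ⁅π2 (X (Sum.inl k0)), z⁆)^[k] (φ z) := by
    intro k
    induction k with
    | zero => intro z; rfl
    | succ k ih =>
      intro z
      rw [Function.iterate_succ_apply, ih, Function.iterate_succ_apply, LieEquiv.map_lie, hx]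
  have hxnil : ∀ z : L1, ∃ k : ℕ, (fun z => ⁅x, z⁆)^[k] z = 0 := by
    intro z
    obtain ⟨k, hk⟩ := hXnil (φ z)
    refine ⟨k, φ.injective ?_⟩
    change φ _ = φ 0
    rw [hxit, hk, map_zero]
  obtain ⟨f0, hf0⟩ := hsurj1 x
  obtain ⟨f, hf, hf00⟩ : ∃ f, π1 f = x ∧ f 0 = 0 := by
    refine ⟨f0 - Finsupp.single 0 (f0 0), ?_, by simp⟩
    rw [map_sub, (hker1 (Finsupp.single 0 (f0 0))).2 ⟨_, rfl⟩, sub_zero, hf0]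
  have hfne : f ≠ 0 := by
    rintro rfl
    exact hxne (by rw [← hf, map_zero])
  obtain ⟨u, hu, humax⟩ := f.support.exists_max_image l (Finsupp.support_nonempty_iff.2 hfne)
  have hfu : f u ≠ 0 := Finsupp.mem_support_iff.1 hu
  have hu0 : u ≠ 0 := by
    rintro rfl
    exact hfu hf00
  have hfx : f u • e u + π1 (f.erase u) = x := by
    rw [← hf]
    conv_rhs => rw [← Finsupp.single_add_erase u f, map_add]
    congr 1
    rw [← map_smul]
    simp
  have hmem : π1 (f.erase u) ∈ Submodule.span F (e '' {z | l z < l u}) := by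
    rw [hspan]
    refine Submodule.mem_map_of_mem ?_
    rw [Finsupp.mem_supported]
    intro z hz
    have hz' := Finset.mem_coe.1 hz
    rw [Finsupp.support_erase, Finset.mem_erase] at hz'
    exact lt_of_le_of_ne (humax z hz'.2) (fun h => hz'.1 (hl h))
  obtain ⟨v, hv⟩ : ∃ v : G, w u v ≠ 0 := by
    by_contra! hcon
    apply hu0
    have h1 : u.1 = 0 := by
      funext k
      have := hcon (0, Pi.single k 1)
      simpa [w, Pi.single_apply] using this
    have h2 : u.2 = 0 := by
      funext k
      have := hcon (Pi.single k 1, 0)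
      simpa [w, Pi.single_apply] using this
    exact Prod.ext h1 h2
  have hwk : ∀ k : ℕ, w u (k • u + v) = w u v := by
    intro k
    refine Finset.sum_congr rfl fun i _ => ?_
    change u.1 i * (k • u.2 i + v.2 i) - (k • u.1 i + v.1 i) * u.2 i = _
    simp only [nsmul_eq_mul]
    ring
  obtain ⟨k, hk⟩ := hxnil (e v)
  obtain ⟨c, hc, y, hy, h⟩ := leading_term_iterate l e w hbr1 u v
    (fun k => by rw [hwk]; exact hv) (f u) hfu _ hmem k
  rw [hfx, hk] at h
  rw [hspan] at hy
  obtain ⟨g, hg, rfl⟩ := hy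
  have hne : k • u + v ≠ 0 := by
    intro h0
    apply hv
    rw [← hwk k, h0]
    simp [w]
  have hgw : g (k • u + v) = 0 := by
    by_contra hcon
    have hlt : l (k • u + v) < l (k • u + v) :=
      hg (Finset.mem_coe.2 (Finsupp.mem_support_iff.2 hcon))
    exact lt_irrefl _ hlt
  have h3 : π1 (Finsupp.single (k • u + v) c + g) = 0 := by
    rw [h, map_add]
    congr 1
    rw [← map_smul]
    simp
  obtain ⟨d, hd⟩ := (hker1 _).1 h3
  have := DFunLike.congr_fun hd (k • u + v)
  rw [Finsupp.add_apply, Finsupp.single_eq_same, hgw, add_zero,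
    Finsupp.single_eq_of_ne hne] at this
  exact hc this
end

section
/- The Lie algebra \overline{H(n,0)} has no nonzero ad-diagonal element with respect to its monomial basis: if l ∈ \overline{H(n,0)} is such that for every u ∈ ℤ^{2n} there exists c_u ∈ F with [l, ē_u] = c_u·ē_u (where ē_u denotes the coset of e_u), then l = 0. -/
set_option synthInstance.maxHeartbeats 1000000
set_option maxHeartbeats 1000000

/-- The Lie algebra `H(n,0)bar` has no nonzero ad-diagonal element
with respect to its monomial basis: if `l` satisfies `[l, ē_u] = c_u·ē_u` for every
`u ∈ ℤ^{2n}` (for some scalars `c_u ∈ F`), then `l = 0`. -/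
theorem exponential_poisson_no_ad_diagonal
    (F : Type*) [Field F] [CharZero F] (n : ℕ) (hn : 0 < n)
    (L : Type*) [LieRing L] [LieAlgebra F L]
    (π : (((Fin n → ℤ) × (Fin n → ℤ)) →₀ F) →ₗ[F] L)
    (hsurj : Function.Surjective π)
    (hker : ∀ f, π f = 0 ↔ ∃ c : F, f = Finsupp.single (0 : (Fin n → ℤ) × (Fin n → ℤ)) c)
    (hbr : ∀ u v : (Fin n → ℤ) × (Fin n → ℤ),
      ⁅π (Finsupp.single u (1 : F)), π (Finsupp.single v (1 : F))⁆ =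
        (∑ k : Fin n, (u.1 k * v.2 k - v.1 k * u.2 k)) • π (Finsupp.single (u + v) (1 : F)))
    (l : L)
    (hl : ∀ u : (Fin n → ℤ) × (Fin n → ℤ), ∃ c : F,
      ⁅l, π (Finsupp.single u (1 : F))⁆ = c • π (Finsupp.single u (1 : F))) :
    l = 0 := by
  classical
  obtain ⟨f, rfl⟩ := hsurj l
  have key : ∀ v, ⁅π f, π (Finsupp.single v (1 : F))⁆ =
      π (∑ u ∈ f.support, Finsupp.single (u + v)
        (f u * ((∑ k : Fin n, (u.1 k * v.2 k - v.1 k * u.2 k) : ℤ) : F))) := by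
    intro v
    have hf : f = ∑ u ∈ f.support, f u • Finsupp.single u (1 : F) := by
      conv_lhs => rw [← Finsupp.sum_single f]
      simp [Finsupp.sum]
    conv_lhs => rw [hf]
    rw [map_sum, map_sum, sum_lie]
    refine Finset.sum_congr rfl fun u _ => ?_
    rw [map_smul, smul_lie, hbr, ← Int.cast_smul_eq_zsmul F, smul_smul, ← map_smul,
      Finsupp.smul_single, smul_eq_mul, mul_one]
  have main : ∀ u v : (Fin n → ℤ) × (Fin n → ℤ),
      (∑ k : Fin n, (u.1 k * v.2 k - v.1 k * u.2 k)) ≠ 0 → f u = 0 := by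
    intro u v huv
    obtain ⟨c, hc⟩ := hl v
    rw [key v, ← map_smul, ← sub_eq_zero, ← map_sub, hker] at hc
    obtain ⟨d, hd⟩ := hc
    have hu : u ≠ 0 := by
      rintro rfl
      simp at huv
    have huv0 : u + v ≠ 0 := by
      intro h
      have hv : v = -u := (neg_eq_of_add_eq_zero_right h).symm
      subst hv
      apply huv
      apply Finset.sum_eq_zero
      intro k _
      simp only [Prod.fst_neg, Prod.snd_neg, Pi.neg_apply]
      ring
    have h := DFunLike.congr_fun hd (u + v)
    rw [Finsupp.sub_apply, Finsupp.finsetSum_apply, Finset.sum_eq_single u] at h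
    · rw [Finsupp.single_eq_same, Finsupp.smul_apply, Finsupp.single_apply, Finsupp.single_apply,
        if_neg (by simpa using hu), if_neg (Ne.symm huv0), smul_zero, sub_zero] at h
      exact (mul_eq_zero.mp h).resolve_right (by exact_mod_cast huv)
    · intro b _ hb
      rw [Finsupp.single_apply, if_neg (by simpa using hb)]
    · intro hu'
      simp [Finsupp.notMem_support_iff.mp hu']
  rw [hker]
  refine ⟨f 0, ?_⟩
  ext u
  rw [Finsupp.single_apply]
  split_ifs with h0
  · rw [h0]
  · by_cases ha : u.1 = 0
    · by_cases hb : u.2 = 0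
      · exact absurd (Prod.ext ha hb : u = 0).symm h0
      · obtain ⟨k, hk⟩ := Function.ne_iff.mp hb
        refine main u (Pi.single k 1, 0) ?_
        simpa [Pi.single_apply] using hk
    · obtain ⟨k, hk⟩ := Function.ne_iff.mp ha
      refine main u (0, Pi.single k 1) ?_
      simpa [Pi.single_apply] using hk
end

section
/- Every derivation D of the Lie algebra \overline{H(n)} is the sum of an inner derivation and a scalar derivation: there exist f ∈ \overline{H(n)} and c ∈ F such that D = ad_f + c·S. -/
set_option synthInstance.maxHeartbeats 1000000
set_option maxHeartbeats 1000000

open MvPolynomial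

section PolyPart
variable {F : Type*} [Field F] {σ : Type*}

theorem pdComm (i j : σ) (p : MvPolynomial σ F) :
    pderiv i (pderiv j p) = pderiv j (pderiv i p) := by
  classical
  have h : ⁅(pderiv i : Derivation F (MvPolynomial σ F) (MvPolynomial σ F)),
      (pderiv j : Derivation F (MvPolynomial σ F) (MvPolynomial σ F))⁆ = 0 := by
    apply derivation_ext
    intro k
    rw [Derivation.commutator_apply, pderiv_X, pderiv_X]
    simp only [Pi.single_apply]
    split_ifs <;> simp
  have h2 := congrArg (fun D => D p) h
  simp only [Derivation.commutator_apply, Derivation.zero_apply] at h2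
  exact sub_eq_zero.mp h2

theorem linExt {M : Type*} [AddCommMonoid M] [Module F M] {f g : MvPolynomial σ F →ₗ[F] M}
    (h : ∀ d, f (monomial d 1) = g (monomial d 1)) : f = g := by
  apply (basisMonomials σ F).ext
  intro d
  simpa using h d

variable [Fintype σ]

noncomputable def Eu : MvPolynomial σ F →ₗ[F] MvPolynomial σ F :=
  ∑ s : σ, (LinearMap.mulLeft F (X s)).comp (pderiv s).toLinearMap

theorem Eu_apply (p : MvPolynomial σ F) : Eu p = ∑ s : σ, X s * pderiv s p := by
  simp [Eu]

noncomputable def TT (k : ℕ) : MvPolynomial σ F →ₗ[F] MvPolynomial σ F :=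
  (basisMonomials σ F).constr F (fun d => (((∑ s, d s + k : ℕ) : F))⁻¹ • monomial d (1 : F))

theorem TT_mon (k : ℕ) (d : σ →₀ ℕ) (a : F) :
    TT k (monomial d a) = (((∑ s, d s + k : ℕ) : F))⁻¹ • monomial d a := by
  have h1 : monomial d a = a • basisMonomials σ F d := by simp [smul_monomial]
  rw [h1, map_smul, TT, Module.Basis.constr_basis, smul_comm]
  simp

theorem Eu_mon (d : σ →₀ ℕ) (a : F) :
    Eu (monomial d a) = ((∑ s, d s : ℕ) : F) • monomial d a := by
  rw [Eu_apply]
  simp only [X_mul_pderiv_monomial]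
  rw [← Finset.sum_smul, ← Nat.cast_smul_eq_nsmul F]

theorem pd_Eu (t : σ) (p : MvPolynomial σ F) :
    pderiv t (Eu p) = Eu (pderiv t p) + pderiv t p := by
  classical
  rw [Eu_apply, Eu_apply, map_sum]
  simp only [Derivation.leibniz, smul_eq_mul, pderiv_X, Pi.single_apply, Finset.sum_add_distrib]
  simp [pdComm t]

theorem Eu_mul (p q : MvPolynomial σ F) : Eu (p * q) = Eu p * q + p * Eu q := by
  simp only [Eu_apply, Finset.sum_mul, Finset.mul_sum, ← Finset.sum_add_distrib]
  apply Finset.sum_congr rfl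
  intro s _
  rw [Derivation.leibniz]
  simp only [smul_eq_mul]
  ring

theorem pd_lin (c : σ → F) (t : σ) :
    pderiv t (∑ s, c s • (X s : MvPolynomial σ F)) = C (c t) := by
  rw [map_sum, Finset.sum_eq_single t]
  · rw [smul_eq_C_mul, pderiv_C_mul, pderiv_X_self, mul_one]
  · intro b _ hb
    rw [smul_eq_C_mul, pderiv_C_mul, pderiv_X_of_ne hb, mul_zero]
  · simp

theorem sumSub (t : σ) (d : σ →₀ ℕ) (h : d t ≠ 0) :
    ∑ s, (d - Finsupp.single t 1 : σ →₀ ℕ) s + 1 = ∑ s, d s := by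
  classical
  have : d = (d - Finsupp.single t 1) + Finsupp.single t 1 := by
    rw [tsub_add_cancel_of_le]
    rw [Finsupp.single_le_iff]; omega
  conv_rhs => rw [this]
  simp [Finset.sum_add_distrib, Finsupp.single_apply]

theorem pd_TT (k : ℕ) (t : σ) (p : MvPolynomial σ F) :
    pderiv t (TT k p) = TT (k+1) (pderiv t p) := by
  have : (pderiv t).toLinearMap.comp (TT k) = (TT (k+1)).comp
      ((pderiv t : Derivation F (MvPolynomial σ F) _).toLinearMap) := by
    apply linExt
    intro d
    simp only [LinearMap.comp_apply, Derivation.coeFn_coe, TT_mon, map_smul, pderiv_monomial]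
    by_cases h : d t = 0
    · simp [h]
    · rw [← sumSub t d h]
      congr 3
      ring
  exact congrArg (fun f => f p) this

variable [CharZero F]

theorem TT_Eu (k : ℕ) (hk : 0 < k) (p : MvPolynomial σ F) :
    TT k (Eu p + (k : F) • p) = p := by
  have : (TT k).comp (Eu + (k : F) • LinearMap.id) = (LinearMap.id : MvPolynomial σ F →ₗ[F] _) := by
    apply linExt
    intro d
    simp only [LinearMap.comp_apply, LinearMap.add_apply, LinearMap.smul_apply, LinearMap.id_apply,
      Eu_mon, ← add_smul, map_smul, TT_mon]
    rw [smul_smul, ← Nat.cast_add, mul_inv_cancel₀, one_smul]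
    exact_mod_cast (by omega)
  exact congrArg (fun f => f p) this

theorem TT_Eu0 (p : MvPolynomial σ F) :
    ∃ c, p = TT 0 (Eu p) + C c := by
  induction p using induction_on' with
  | monomial d a =>
    by_cases h : ∑ s, d s = 0
    · refine ⟨a, ?_⟩
      have hd : d = 0 := by
        ext s
        exact (Finset.sum_eq_zero_iff.mp h) s (Finset.mem_univ s)
      subst hd
      rw [Eu_mon, h]
      simp
    · refine ⟨0, ?_⟩
      rw [Eu_mon, map_smul, TT_mon, smul_smul, add_zero, mul_inv_cancel₀]
      · simp
      · exact_mod_cast h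
  | add p q hp hq =>
    obtain ⟨a, ha⟩ := hp
    obtain ⟨b, hb⟩ := hq
    refine ⟨a + b, ?_⟩
    conv_lhs => rw [ha, hb]
    simp only [map_add]
    ring

theorem const_of_pd (p : MvPolynomial σ F) (h : ∀ s, pderiv s p = 0) : ∃ c, p = C c := by
  obtain ⟨c, hc⟩ := TT_Eu0 p
  refine ⟨c, ?_⟩
  rw [Eu_apply] at hc
  simpa [h] using hc

theorem affine_of_pd (p : MvPolynomial σ F) (c : σ → F) (h : ∀ s, pderiv s p = C (c s)) :
    ∃ c0, p = ∑ s, c s • X s + C c0 := by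
  classical
  obtain ⟨c0, h0⟩ := const_of_pd (p - ∑ s, c s • X s) (by
    intro t
    rw [map_sub, h, pd_lin, sub_self])
  exact ⟨c0, by rw [← h0]; ring⟩

/-- Poincare lemma up to constants. -/
theorem poincare (q : σ → MvPolynomial σ F) (ω : σ → σ → F)
    (h : ∀ a b, pderiv b (q a) - pderiv a (q b) = C (ω b a)) :
    ∃ (f : MvPolynomial σ F) (W : σ → σ → F), (∀ a b, W a b = - W b a) ∧
      ∀ t u, pderiv u (pderiv t f - q t) = C (W t u) := by
  classical
  refine ⟨TT 0 (∑ s, X s * q s), fun a b => ω a b / 2, ?_, ?_⟩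
  · intro a b
    have h1 := h a b
    have h2 := h b a
    have h3 : (C (ω a b) : MvPolynomial σ F) = C (- ω b a) := by
      rw [map_neg, ← h1, ← h2]; ring
    have h4 := C_injective _ _ h3
    simp only [h4]; ring
  · intro t u
    have h1 : pderiv t (∑ s, X s * q s) = (Eu (q t) + ((1:ℕ):F) • q t) + ∑ s, ω t s • X s := by
      rw [map_sum, Eu_apply]
      have : ∀ s, pderiv t (X s * q s) = X s * pderiv s (q t) + (if s = t then q t else 0)
          + ω t s • X s := by
        intro s
        have h2 : pderiv t (q s) = pderiv s (q t) + C (ω t s) := by rw [← h s t]; ring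
        rw [Derivation.leibniz, h2, pderiv_X]
        simp only [Pi.single_apply, smul_eq_mul, smul_eq_C_mul]
        split_ifs with hst
        · subst hst; simp; ring
        · simp; ring
      simp only [this, Finset.sum_add_distrib]
      simp
    rw [pd_TT, h1, map_add, TT_Eu 1 one_pos, map_sum, add_sub_cancel_left]
    have h2 : ∀ s, TT (0+1) (ω t s • (X s : MvPolynomial σ F)) = (ω t s / 2) • X s := by
      intro s
      rw [map_smul, X, TT_mon, smul_smul]
      congr 1
      simp [Finsupp.single_apply]
      norm_num
      ring
    simp only [h2]
    exact pd_lin _ _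

end PolyPart

section PoissonPart
variable {F : Type*} [Field F] {n : ℕ}

/-- sign -/
noncomputable def eps (F : Type*) [Field F] {n : ℕ} : Fin n ⊕ Fin n → F :=
  Sum.elim (fun _ => 1) (fun _ => -1)

theorem eps_sq (s : Fin n ⊕ Fin n) : eps F s * eps F s = 1 := by
  rcases s with s | s <;> simp [eps]

theorem eps_ne (s : Fin n ⊕ Fin n) : eps F s ≠ 0 := by
  rcases s with s | s <;> simp [eps]

theorem eps_swap (s : Fin n ⊕ Fin n) : eps F s.swap = - eps F s := by
  rcases s with s | s <;> simp [eps]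

noncomputable def pb (f g : MvPolynomial (Fin n ⊕ Fin n) F) : MvPolynomial (Fin n ⊕ Fin n) F :=
  ∑ k : Fin n, (pderiv (Sum.inl k) f * pderiv (Sum.inr k) g
          - pderiv (Sum.inr k) f * pderiv (Sum.inl k) g)

theorem pb_eq (f g : MvPolynomial (Fin n ⊕ Fin n) F) :
    pb f g = ∑ s, eps F s • (pderiv s f * pderiv s.swap g) := by
  rw [pb, Fintype.sum_sum_type, ← Finset.sum_add_distrib]
  apply Finset.sum_congr rfl
  intro k _
  simp [eps, sub_eq_add_neg]

theorem pb_antisymm (f g : MvPolynomial (Fin n ⊕ Fin n) F) : pb f g = - pb g f := by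
  rw [pb, pb, ← Finset.sum_neg_distrib]
  apply Finset.sum_congr rfl
  intro k _
  ring

theorem pb_X_left (s : Fin n ⊕ Fin n) (g : MvPolynomial (Fin n ⊕ Fin n) F) :
    pb (X s) g = eps F s • pderiv s.swap g := by
  rw [pb_eq, Finset.sum_eq_single s]
  · rw [pderiv_X_self, one_mul]
  · intro b _ hb
    rw [pderiv_X_of_ne hb.symm, zero_mul, smul_zero]
  · simp

theorem pb_X_right (s : Fin n ⊕ Fin n) (g : MvPolynomial (Fin n ⊕ Fin n) F) :
    pb g (X s) = (- eps F s) • pderiv s.swap g := by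
  rw [pb_antisymm, pb_X_left, neg_smul]

theorem pb_mul_right (f g h : MvPolynomial (Fin n ⊕ Fin n) F) :
    pb f (g * h) = g * pb f h + h * pb f g := by
  simp only [pb, Finset.mul_sum, ← Finset.sum_add_distrib]
  apply Finset.sum_congr rfl
  intro k _
  simp only [Derivation.leibniz, smul_eq_mul]
  ring

theorem pb_mul_left (f g h : MvPolynomial (Fin n ⊕ Fin n) F) :
    pb (g * h) f = g * pb h f + h * pb g f := by
  rw [pb_antisymm, pb_mul_right, pb_antisymm f h, pb_antisymm f g]
  ring

theorem pb_Eu (f g : MvPolynomial (Fin n ⊕ Fin n) F) :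
    pb (Eu f) g + pb f (Eu g) = Eu (pb f g) + (2 : F) • pb f g := by
  simp only [pb, map_sum, Finset.smul_sum, ← Finset.sum_add_distrib]
  apply Finset.sum_congr rfl
  intro k _
  simp only [pd_Eu, map_sub, Eu_mul, two_smul]
  ring

noncomputable def hh (F : Type*) [Field F] (n : ℕ) : MvPolynomial (Fin n ⊕ Fin n) F :=
  ∑ k : Fin n, X (Sum.inl k) * X (Sum.inr k)

theorem pb_hh (g : MvPolynomial (Fin n ⊕ Fin n) F) :
    pb (hh F n) g = ∑ s, (- eps F s) • (X s * pderiv s g) := by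
  have h1 : pb (hh F n) g = ∑ k : Fin n, pb (X (Sum.inl k) * X (Sum.inr k)) g := by
    simp only [hh, pb, map_sum, Finset.sum_mul, ← Finset.sum_sub_distrib]
    rw [Finset.sum_comm]
  rw [h1, Fintype.sum_sum_type, ← Finset.sum_add_distrib]
  apply Finset.sum_congr rfl
  intro k _
  rw [pb_mul_left, pb_X_left, pb_X_left]
  simp [eps]

theorem pb_hh_mon (d : Fin n ⊕ Fin n →₀ ℕ) (a : F) :
    pb (hh F n) (monomial d a) = (∑ s, (- eps F s) * (d s : F)) • monomial d a := by
  rw [pb_hh, Finset.sum_smul]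
  apply Finset.sum_congr rfl
  intro s _
  rw [X_mul_pderiv_monomial, ← Nat.cast_smul_eq_nsmul F, smul_smul]

theorem pb_hh_X (s : Fin n ⊕ Fin n) :
    pb (hh F n) (X s) = (- eps F s) • X s := by
  rw [pb_hh, Finset.sum_eq_single s]
  · rw [pderiv_X_self, mul_one]
  · intro b _ hb
    rw [pderiv_X_of_ne hb.symm, mul_zero, smul_zero]
  · simp

variable {L : Type*} [LieRing L] [LieAlgebra F L]
    (π : MvPolynomial (Fin n ⊕ Fin n) F →ₗ[F] L)
    (hsurj : Function.Surjective π)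
    (hker : ∀ f, π f = 0 ↔ ∃ c : F, f = MvPolynomial.C c)
    (hbr : ∀ f g, ⁅π f, π g⁆ = π (pb f g))

include hker in
theorem pi_C (c : F) : π (C c) = 0 := (hker _).2 ⟨c, rfl⟩

include hker hbr in
theorem lie_XX (s t : Fin n ⊕ Fin n) : ⁅π (X s), π (X t)⁆ = 0 := by
  classical
  rw [hbr, pb_X_left, pderiv_X, map_smul]
  rw [Pi.single_apply]
  split_ifs
  · rw [← C_1, pi_C π hker, smul_zero]
  · simp

include hbr in
theorem lie_hX (s : Fin n ⊕ Fin n) : ⁅π (hh F n), π (X s)⁆ = (- eps F s) • π (X s) := by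
  rw [hbr, pb_hh_X, map_smul]

include hsurj hker hbr in
theorem lin_of_comm [CharZero F] (v : L) (h : ∀ s, ⁅π (X s), v⁆ = 0) :
    ∃ c : Fin n ⊕ Fin n → F, v = ∑ s, c s • π (X s) := by
  obtain ⟨p, rfl⟩ := hsurj v
  have h1 : ∀ s, ∃ c, pderiv s p = C c := by
    intro s
    have h2 := h s.swap
    rw [hbr, pb_X_left, map_smul, Sum.swap_swap, smul_eq_zero_iff_right (eps_ne _), hker] at h2
    exact h2
  choose c hc using h1
  obtain ⟨c0, h0⟩ := affine_of_pd p c hc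
  refine ⟨c, ?_⟩
  rw [h0, map_add, pi_C π hker, add_zero, map_sum]
  simp only [map_smul]

include hsurj hker hbr in
/-- Step A of the vanishing argument. -/
theorem vanishA [CharZero F] (D : L →ₗ[F] L) (hD : ∀ f g : L, D ⁅f, g⁆ = ⁅D f, g⁆ + ⁅f, D g⁆)
    (hX : ∀ s, D (π (X s)) = 0) (hH : D (π (hh F n)) = 0)
    (d : Fin n ⊕ Fin n →₀ ℕ) (hd : ∀ t, D (π (pderiv t (monomial d 1))) = 0)
    (hw : (∑ s, (- eps F s) * (d s : F)) ^ 2 ≠ 1) : D (π (monomial d 1)) = 0 := by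
  obtain ⟨c, hc⟩ := lin_of_comm π hsurj hker hbr (D (π (monomial d 1))) (by
    intro s
    have h := hD (π (X s)) (π (monomial d 1))
    rw [hX, zero_lie, zero_add] at h
    rw [← h, hbr, pb_X_left, map_smul, map_smul, hd, smul_zero])
  set w := ∑ s, (- eps F s) * (d s : F) with hwd
  set v := D (π (monomial d 1)) with hv
  have h1 : ⁅π (hh F n), v⁆ = w • v := by
    have h := hD (π (hh F n)) (π (monomial d 1))
    rw [hH, zero_lie, zero_add] at h
    rw [← h, hbr, pb_hh_mon, map_smul, map_smul]
  have h2 : ⁅π (hh F n), ⁅π (hh F n), v⁆⁆ = v := by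
    rw [hc, lie_sum, lie_sum]
    apply Finset.sum_congr rfl
    intro s _
    rw [lie_smul, lie_hX π hbr, lie_smul, lie_smul, lie_hX π hbr, smul_smul (-eps F s), neg_mul_neg,
      eps_sq, one_smul]
  rw [h1, lie_smul, h1, smul_smul] at h2
  have h3 : (w ^ 2 - 1) • v = 0 := by
    rw [sub_smul, one_smul, pow_two, h2, sub_self]
  rcases smul_eq_zero.mp h3 with h | h
  · exact absurd (sub_eq_zero.mp h) hw
  · exact h

include hsurj hker hbr in
theorem vanish [CharZero F] (D : L →ₗ[F] L) (hD : ∀ f g : L, D ⁅f, g⁆ = ⁅D f, g⁆ + ⁅f, D g⁆)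
    (hX : ∀ s, D (π (X s)) = 0) (hH : D (π (hh F n)) = 0) : ∀ v, D v = 0 := by
  classical
  have hC : ∀ c : F, D (π (C c)) = 0 := fun c => by rw [pi_C π hker, map_zero]
  -- squares
  have hsq : ∀ s, D (π (X s * X s)) = 0 := by
    intro s
    have h1 : (X s * X s : MvPolynomial (Fin n ⊕ Fin n) F) = monomial (Finsupp.single s 2) 1 := by
      rw [← pow_two, X_pow_eq_monomial]
    rw [h1]
    apply vanishA π hsurj hker hbr D hD hX hH
    · intro t
      rw [← h1, Derivation.leibniz, pderiv_X, Pi.single_apply]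
      split_ifs <;> simp [hX]
    · rw [Finset.sum_eq_single s]
      · have := eps_sq (F := F) s
        simp only [Finsupp.single_eq_same]
        intro h
        have h4 : (4 : F) = 1 := by
          rw [← h]; push_cast; linear_combination (-4) * this
        norm_num at h4
      · intro b _ hb
        rw [Finsupp.single_eq_of_ne hb]; simp
      · simp
  have key : ∀ (m : ℕ) (d : Fin n ⊕ Fin n →₀ ℕ), ∑ s, d s = m → D (π (monomial d 1)) = 0 := by
    intro m
    induction m with
    | zero =>
      intro d hd
      have : d = 0 := by
        ext s
        exact (Finset.sum_eq_zero_iff.mp hd) s (Finset.mem_univ s)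
      subst this
      exact hC 1
    | succ m ih =>
      have A : ∀ d : Fin n ⊕ Fin n →₀ ℕ, ∑ s, d s = m + 1 →
          (∑ s, (- eps F s) * (d s : F)) ^ 2 ≠ 1 → D (π (monomial d 1)) = 0 := by
        intro d hd hw
        refine vanishA π hsurj hker hbr D hD hX hH d ?_ hw
        intro t
        by_cases ht : d t = 0
        · simp [pderiv_monomial, ht]
        · have h1 := sumSub t d ht
          rw [pderiv_monomial, ← mul_one (1 * (d t : F)), ← smul_eq_mul, ← smul_monomial,
            map_smul, map_smul, ih _ (by omega), smul_zero]
      intro d hd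
      by_cases hw : (∑ s, (- eps F s) * (d s : F)) ^ 2 = 1
      · by_cases hm : m = 0
        · -- degree one
          obtain ⟨s, hs⟩ : ∃ s, d s ≠ 0 := by
            by_contra! h
            simp [h] at hd
          have h1 := sumSub s d hs
          have h2 : d - Finsupp.single s 1 = 0 := by
            ext u
            exact (Finset.sum_eq_zero_iff.mp (by omega)) u (Finset.mem_univ u)
          have h3 : d = Finsupp.single s 1 := by
            have : d = (d - Finsupp.single s 1) + Finsupp.single s 1 := by
              rw [tsub_add_cancel_of_le]
              rw [Finsupp.single_le_iff]; omega
            rw [this, h2, zero_add]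
          rw [h3]
          exact hX s
        · obtain ⟨s, hs, hse⟩ : ∃ s, d s ≠ 0 ∧
              ∑ s, (- eps F s) * (d s : F) = eps F s := by
            by_contra! hcon
            obtain ⟨δ, hδ⟩ : ∃ δ : F, ∑ s, (- eps F s) * (d s : F) = δ := ⟨_, rfl⟩
            have h1 : ∀ s, (- eps F s) * (d s : F) = δ * d s := by
              intro s
              by_cases hs : d s = 0
              · simp [hs]
              · have h2 := hcon s hs
                rw [hδ] at h2 hw
                have h3 : (δ - eps F s) * (δ + eps F s) = 0 := by
                  linear_combination hw - eps_sq (F := F) s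
                rcases mul_eq_zero.mp h3 with h | h
                · exact absurd (sub_eq_zero.mp h) h2
                · rw [eq_neg_of_add_eq_zero_left h]
            have h2 : δ * (m + 1 : ℕ) = δ := by
              rw [← hd]
              push_cast
              rw [Finset.mul_sum]
              conv_rhs => rw [← hδ]
              exact Finset.sum_congr rfl (fun s _ => (h1 s).symm)
            have h3 : δ ≠ 0 := by
              rw [hδ] at hw
              rintro rfl
              simp at hw
            have h4 : ((m + 1 : ℕ) : F) = ((1 : ℕ) : F) := by
              apply mul_left_cancel₀ h3
              rw [h2]; simp
            have := Nat.cast_injective h4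
            omega
          set e : Fin n ⊕ Fin n →₀ ℕ := d - Finsupp.single s 1 with he
          have hde : d = e + Finsupp.single s 1 := by
            rw [he, tsub_add_cancel_of_le]
            rw [Finsupp.single_le_iff]; omega
          have h1 := sumSub s d hs
          rw [← he] at h1
          set d' := e + Finsupp.single s.swap 1 with hd'
          have hDd' : D (π (monomial d' 1)) = 0 := by
            apply A
            · rw [hd']
              simp only [Finsupp.add_apply, Finset.sum_add_distrib]
              have h7 : ∑ u, (Finsupp.single s.swap 1 : Fin n ⊕ Fin n →₀ ℕ) u = 1 := by
                simp [Finsupp.single_apply]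
              omega
            · have hw' : ∑ u, (- eps F u) * (d' u : F) = 3 * eps F s := by
                have e1 : ∑ u, (- eps F u) * (d u : F) =
                    ∑ u, (- eps F u) * (e u : F) - eps F s := by
                  rw [hde]
                  simp [mul_add, Finset.sum_add_distrib, Finsupp.single_apply, sub_eq_add_neg]
                have e2 : ∑ u, (- eps F u) * (d' u : F) =
                    ∑ u, (- eps F u) * (e u : F) - eps F s.swap := by
                  rw [hd']
                  simp [mul_add, Finset.sum_add_distrib, Finsupp.single_apply, sub_eq_add_neg]
                rw [e2, eps_swap]
                linear_combination hse - e1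
              rw [hw']
              intro h
              have h9 : (9 : F) = 1 := by
                rw [← h]; linear_combination (-9) * eps_sq (F := F) s
              norm_num at h9
          have hbk : pb (X s * X s) (monomial d' (1 : F)) =
              (2 * eps F s * (d' s.swap : F)) • monomial d 1 := by
            rw [pb_mul_left, pb_X_left, pderiv_monomial]
            have e3 : d' - Finsupp.single s.swap 1 = e := by
              rw [hd', add_tsub_cancel_right]
            rw [e3, hde, mul_smul_comm, X, monomial_mul, smul_monomial, smul_monomial, ← map_add,
              add_comm e]
            congr 1
            simp only [smul_eq_mul]
            ring
          have h5 := hD (π (X s * X s)) (π (monomial d' 1))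
          rw [hsq, hDd', zero_lie, lie_zero, add_zero, hbr, hbk, map_smul, map_smul] at h5
          rcases smul_eq_zero.mp h5 with h | h
          · exfalso
            have h6 : (d' s.swap : F) ≠ 0 := by
              rw [hd']
              simp only [Finsupp.add_apply, Finsupp.single_eq_same]
              exact Nat.cast_ne_zero.mpr (by omega)
            exact mul_ne_zero (mul_ne_zero two_ne_zero (eps_ne s)) h6 h
          · exact h
      · exact A d hd hw
  intro v
  obtain ⟨p, rfl⟩ := hsurj v
  have : D.comp π = 0 := by
    apply linExt
    intro d
    simpa using key _ d rfl
  exact congrArg (fun f => f p) this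

include hsurj hker hbr in
theorem scalar_step [CharZero F] (D : L →ₗ[F] L)
    (hD : ∀ f g : L, D ⁅f, g⁆ = ⁅D f, g⁆ + ⁅f, D g⁆)
    (r : Fin n ⊕ Fin n → MvPolynomial (Fin n ⊕ Fin n) F) (W : Fin n ⊕ Fin n → Fin n ⊕ Fin n → F)
    (hW : ∀ a b, W a b = - W b a) (hr : ∀ t u, pderiv u (r t) = C (W t u))
    (hX : ∀ s, D (π (X s)) = eps F s • π (r s.swap)) (hn : 0 < n) :
    ∃ c : F, ∀ s, D (π (X s)) = c • π (X s) := by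
  classical
  let δ : Fin n ⊕ Fin n → Fin n ⊕ Fin n → F := fun a t => if a = t then 1 else 0
  have hδ : ∀ a t, pderiv t (X a : MvPolynomial (Fin n ⊕ Fin n) F) = C (δ a t) := by
    intro a t
    rw [pderiv_X, Pi.single_apply]
    simp only [δ]
    split_ifs <;> simp
  have key : ∀ a b t u,
      δ a t * (eps F b * W b.swap u) + δ b t * (eps F a * W a.swap u)
        + eps F b * W t b.swap * δ a u + eps F a * W t a.swap * δ b u =
      δ a u * (eps F b * W b.swap t) + δ b u * (eps F a * W a.swap t)
        + eps F b * W u b.swap * δ a t + eps F a * W u a.swap * δ b t := by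
    intro a b
    obtain ⟨Q, hQ⟩ := hsurj (D (π (X a * X b)))
    have h1 : ∀ t, ∃ c, pderiv t Q = (δ a t * eps F b) • r b.swap + (δ b t * eps F a) • r a.swap
        + (eps F b * W t b.swap) • X a + (eps F a * W t a.swap) • X b + C c := by
      intro t
      have h2 := hD (π (X t.swap)) (π (X a * X b))
      have hpb : pb (r t) (X a * X b) =
          -((eps F b * W t b.swap) • X a + (eps F a * W t a.swap) • X b) := by
        rw [pb_mul_right, pb_X_right, pb_X_right, hr, hr]
        simp only [smul_eq_C_mul, map_mul, map_neg]
        ring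
      have hq : pderiv t (X a * X b : MvPolynomial (Fin n ⊕ Fin n) F) =
          δ b t • X a + δ a t • X b := by
        rw [Derivation.leibniz, hδ, hδ]
        simp only [smul_eq_C_mul, smul_eq_mul]
        ring
      rw [hX, ← hQ, hbr, hbr (X t.swap) Q, pb_X_left, pb_X_left, Sum.swap_swap, smul_lie, hbr, hpb,
        hq, map_smul, map_smul, map_smul, ← smul_add] at h2
      have h3 := smul_right_injective L (eps_ne (F := F) t.swap) h2
      simp only [map_add, map_smul, hX] at h3
      have h4 : π (pderiv t Q - ((δ a t * eps F b) • r b.swap + (δ b t * eps F a) • r a.swap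
        + (eps F b * W t b.swap) • X a + (eps F a * W t a.swap) • X b)) = 0 := by
        simp only [map_sub, map_add, map_smul, map_neg] at h3 ⊢
        rw [sub_eq_zero, ← sub_eq_zero]
        have h5 := sub_eq_zero.mpr h3
        rw [← neg_eq_zero, ← h5]
        module
      obtain ⟨c, hc⟩ := (hker _).1 h4
      exact ⟨c, by rw [← hc]; ring⟩
    choose c hc using h1
    have h2 : ∀ t u, pderiv u (pderiv t Q) =
        C (δ a t * (eps F b * W b.swap u) + δ b t * (eps F a * W a.swap u)
        + eps F b * W t b.swap * δ a u + eps F a * W t a.swap * δ b u) := by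
      intro t u
      rw [hc]
      simp only [smul_eq_C_mul]
      rw [map_add, map_add, map_add, map_add, pderiv_C_mul, pderiv_C_mul, pderiv_C_mul,
        pderiv_C_mul, pderiv_C, hr, hr, hδ, hδ]
      simp only [map_add, map_mul]
      ring
    intro t u
    apply C_injective (Fin n ⊕ Fin n) F
    rw [← h2, ← h2, pdComm]
  have h0 : ∀ a u, u ≠ a → W a.swap u = 0 := by
    intro a u hu
    have h1 := key a a a u
    rw [hW u a.swap] at h1
    simp only [δ, if_neg hu.symm, if_true] at h1
    have h2 : (4 * eps F a) * W a.swap u = 0 := by linear_combination h1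
    rcases mul_eq_zero.mp h2 with h | h
    · exact absurd h (mul_ne_zero (by norm_num : (4 : F) ≠ 0) (eps_ne a))
    · exact h
  have h1 : ∀ a b, eps F a * W a.swap a = eps F b * W b.swap b := by
    intro a b
    by_cases hab : a = b
    · rw [hab]
    · have h1 := key a b a b
      rw [hW a a.swap, hW b b.swap] at h1
      simp only [δ, if_neg hab, if_neg (Ne.symm hab), if_true] at h1
      have h2 : (2 : F) * (eps F a * W a.swap a - eps F b * W b.swap b) = 0 := by
        linear_combination -h1
      rcases mul_eq_zero.mp h2 with h | h
      · exact absurd h two_ne_zero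
      · exact sub_eq_zero.mp h
  refine ⟨eps F (Sum.inl ⟨0, hn⟩) * W (Sum.inl ⟨0, hn⟩ : Fin n ⊕ Fin n).swap (Sum.inl ⟨0, hn⟩), ?_⟩
  intro s
  rw [← h1 s, hX, mul_smul]
  congr 1
  rw [← sub_eq_zero, ← map_smul, ← map_sub, hker]
  apply const_of_pd
  intro u
  rw [map_sub, hr, smul_eq_C_mul, pderiv_C_mul, hδ]
  by_cases hu : u = s
  · subst hu; simp [δ]
  · simp [δ, h0 s u hu, Ne.symm hu]

include hsurj hker hbr in
theorem inner_step [CharZero F] (D : L →ₗ[F] L)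
    (hD : ∀ f g : L, D ⁅f, g⁆ = ⁅D f, g⁆ + ⁅f, D g⁆) :
    ∃ (f : L) (r : Fin n ⊕ Fin n → MvPolynomial (Fin n ⊕ Fin n) F)
      (W : Fin n ⊕ Fin n → Fin n ⊕ Fin n → F),
      (∀ a b, W a b = - W b a) ∧ (∀ t u, pderiv u (r t) = C (W t u)) ∧
      ∀ s, D (π (X s)) - ⁅f, π (X s)⁆ = eps F s • π (r s.swap) := by
  have h1 : ∀ s, ∃ p, π p = D (π (X s)) := fun s => hsurj _
  choose p hp using h1
  have h2 : ∀ a b, ∃ c, pderiv b (eps F a • p a.swap) - pderiv a (eps F b • p b.swap) = C c := by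
    intro a b
    have h := hD (π (X a.swap)) (π (X b.swap))
    rw [lie_XX π hker hbr, map_zero, ← hp, ← hp, hbr, hbr, pb_X_left, pb_X_right, Sum.swap_swap,
      Sum.swap_swap, eps_swap, eps_swap, neg_neg, ← map_add] at h
    obtain ⟨c, hc⟩ := (hker _).1 h.symm
    refine ⟨eps F a * eps F b * c, ?_⟩
    rw [map_mul, ← hc]
    have ha : (C (eps F a) * C (eps F a) : MvPolynomial (Fin n ⊕ Fin n) F) = 1 := by
      rw [← map_mul, eps_sq, C_1]
    have hb : (C (eps F b) * C (eps F b) : MvPolynomial (Fin n ⊕ Fin n) F) = 1 := by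
      rw [← map_mul, eps_sq, C_1]
    simp only [smul_eq_C_mul, pderiv_C_mul, map_mul, map_neg]
    linear_combination (-(C (eps F a) * pderiv b (p a.swap))) * hb
      + (C (eps F b) * pderiv a (p b.swap)) * ha
  choose ω hω using h2
  obtain ⟨f, W, hW, hf⟩ := poincare (fun a => eps F a • p a.swap) (fun b a => ω a b) hω
  refine ⟨π f, fun t => pderiv t f - eps F t • p t.swap, W, hW, hf, ?_⟩
  intro s
  rw [hbr, pb_X_right, ← hp]
  simp only [Sum.swap_swap, eps_swap, map_sub, map_smul, smul_sub, smul_smul]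
  rw [mul_neg, eps_sq]
  module

end PoissonPart

/-- Every derivation `D` of the Poisson Lie algebra
`H(n)bar = F[x_1,…,x_n,y_1,…,y_n]/F` is the sum of an inner derivation and a scalar
derivation: there exist `f ∈ H(n)bar` and `c ∈ F` with `D = ad_f + c·S`, where `S`
is the scalar derivation sending the coset of each monomial to
`(2 − Σ_k a_k − Σ_k b_k)` times itself. -/
theorem poisson_derivations_inner_plus_scalar
    (F : Type*) [Field F] [CharZero F] (n : ℕ) (hn : 0 < n)
    (L2 : Type*) [LieRing L2] [LieAlgebra F L2]
    (π2 : MvPolynomial (Fin n ⊕ Fin n) F →ₗ[F] L2)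
    (hsurj2 : Function.Surjective π2)
    (hker2 : ∀ f, π2 f = 0 ↔ ∃ c : F, f = MvPolynomial.C c)
    (hbr2 : ∀ f g, ⁅π2 f, π2 g⁆ =
      π2 (∑ k : Fin n,
        (pderiv (Sum.inl k) f * pderiv (Sum.inr k) g
          - pderiv (Sum.inr k) f * pderiv (Sum.inl k) g)))
    (S : L2 →ₗ[F] L2)
    (hS : ∀ d : (Fin n ⊕ Fin n) →₀ ℕ,
      S (π2 (monomial d (1 : F))) =
        ((2 : ℤ) - ∑ s : Fin n ⊕ Fin n, (d s : ℤ)) • π2 (monomial d (1 : F)))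
    (D : L2 →ₗ[F] L2)
    (hD : ∀ f g : L2, D ⁅f, g⁆ = ⁅D f, g⁆ + ⁅f, D g⁆) :
    ∃ (f : L2) (c : F), ∀ g : L2, D g = ⁅f, g⁆ + c • S g := by
  have hbr : ∀ f g, ⁅π2 f, π2 g⁆ = π2 (pb f g) := hbr2
  obtain ⟨f, r, W, hW, hr, hX⟩ := inner_step π2 hsurj2 hker2 hbr D hD
  obtain ⟨c, hc⟩ := scalar_step π2 hsurj2 hker2 hbr (D - LieAlgebra.ad F L2 f)
    (by
      intro a b
      simp only [LinearMap.sub_apply, LieAlgebra.ad_apply, hD, leibniz_lie f a b, sub_lie, lie_sub]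
      abel) r W hW hr (by intro s; simpa using hX s) hn
  have hSE : ∀ p, S (π2 p) = π2 ((2 : F) • p - Eu p) := by
    intro p
    have : S.comp π2 = π2.comp ((2 : F) • LinearMap.id - Eu) := by
      apply linExt
      intro d
      simp only [LinearMap.comp_apply, hS, LinearMap.sub_apply, LinearMap.smul_apply,
        LinearMap.id_apply, Eu_mon, ← sub_smul, map_smul]
      rw [← Int.cast_smul_eq_zsmul F]
      congr 1
      push_cast
      rfl
    exact congrArg (fun g => g p) this
  have hSD : ∀ a b, S ⁅a, b⁆ = ⁅S a, b⁆ + ⁅a, S b⁆ := by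
    intro a b
    obtain ⟨p, rfl⟩ := hsurj2 a
    obtain ⟨q, rfl⟩ := hsurj2 b
    rw [hbr, hSE, hSE, hSE, map_sub, map_sub, map_sub, sub_lie, lie_sub, map_smul, map_smul,
      map_smul, smul_lie, lie_smul, hbr, hbr, hbr]
    have h := congrArg π2 (pb_Eu p q)
    simp only [map_add, map_smul] at h
    have h' : π2 (pb p (Eu q)) = π2 (Eu (pb p q)) + (2 : F) • π2 (pb p q) - π2 (pb (Eu p) q) := by
      rw [← h]; abel
    rw [h']
    module
  have hSX : ∀ s, S (π2 (X s)) = π2 (X s) := by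
    intro s
    rw [hSE]
    congr 1
    rw [X, Eu_mon]
    classical
    simp [Finsupp.single_apply]
    module
  let D1 : L2 →ₗ[F] L2 := D - LieAlgebra.ad F L2 f - c • S
  have hD1 : ∀ a b : L2, D1 ⁅a, b⁆ = ⁅D1 a, b⁆ + ⁅a, D1 b⁆ := by
    intro a b
    simp only [D1, LinearMap.sub_apply, LieAlgebra.ad_apply, hD, leibniz_lie f a b, sub_lie,
      lie_sub, LinearMap.smul_apply, hSD, smul_add, smul_lie, lie_smul]
    abel
  have hX1 : ∀ s, D1 (π2 (X s)) = 0 := by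
    intro s
    have := hc s
    simp only [D1]
    rw [LinearMap.sub_apply, this, LinearMap.smul_apply, hSX, sub_self]
  obtain ⟨e, he⟩ := lin_of_comm π2 hsurj2 hker2 hbr (D1 (π2 (hh F n))) (by
    intro s
    have h := hD1 (π2 (X s)) (π2 (hh F n))
    rw [hX1, zero_lie, zero_add] at h
    rw [← h, ← lie_skew, lie_hX π2 hbr, map_neg, map_smul, hX1, smul_zero, neg_zero])
  let v : L2 := ∑ s, (e s * eps F s) • π2 (X s)
  have hvX : ∀ s, ⁅v, π2 (X s)⁆ = 0 := by
    intro s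
    simp only [v]
    rw [sum_lie]
    apply Finset.sum_eq_zero
    intro t _
    rw [smul_lie, lie_XX π2 hker2 hbr, smul_zero]
  have hvH : ⁅v, π2 (hh F n)⁆ = D1 (π2 (hh F n)) := by
    rw [he]
    simp only [v]
    rw [sum_lie]
    apply Finset.sum_congr rfl
    intro t _
    rw [smul_lie, ← lie_skew, lie_hX π2 hbr, neg_smul, neg_neg, smul_smul, mul_assoc, eps_sq,
      mul_one]
  have hfin := vanish π2 hsurj2 hker2 hbr (D1 - LieAlgebra.ad F L2 v)
    (by
      intro a b
      simp only [LinearMap.sub_apply, LieAlgebra.ad_apply, hD1, leibniz_lie v a b, sub_lie, lie_sub]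
      abel)
    (by
      intro s
      rw [LinearMap.sub_apply, hX1, LieAlgebra.ad_apply, hvX, sub_zero])
    (by
      rw [LinearMap.sub_apply, ← hvH]
      simp)
  refine ⟨f + v, c, ?_⟩
  intro g
  have h := hfin g
  simp only [D1, LinearMap.sub_apply, LieAlgebra.ad_apply, LinearMap.smul_apply] at h
  rw [add_lie, ← sub_eq_zero, ← h]
  abel
end

section
/- The Lie algebra \overline{H(n,n)} has no nonzero ad-diagonal element with respect to its monomial basis: if l ∈ \overline{H(n,n)} is such that for every index (a,i,b,j) ∈ ℤ^{4n} there exists a scalar c ∈ F with {l, m̄(a,i,b,j)} = c·m̄(a,i,b,j) (where m̄(a,i,b,j) denotes the coset of the basis monomial m(a,i,b,j)), then l = 0. -/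
set_option synthInstance.maxHeartbeats 1000000
set_option maxHeartbeats 1000000

/-- Coefficients of a first-order operator. -/
theorem gp_coeff_D {F G : Type*} [Field F] [AddCommGroup G]
    (D : AddMonoidAlgebra F G →ₗ[F] AddMonoidAlgebra F G) (α ι : G → ℤ) (u : G)
    (hι : ∀ g, ι (g + u) = ι g + 1)
    (hD : ∀ g, D (AddMonoidAlgebra.single g 1) =
      (α g) • AddMonoidAlgebra.single g (1 : F) + (ι g) • AddMonoidAlgebra.single (g - u) (1 : F))
    (f : AddMonoidAlgebra F G) (g : G) :
    (D f).coeff g = (α g : F) * f.coeff g + ((ι g : F) + 1) * f.coeff (g + u) := by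
  classical
  induction f using AddMonoidAlgebra.induction_linear with
  | zero => simp
  | add x y hx hy =>
    rw [map_add, AddMonoidAlgebra.coeff_add, AddMonoidAlgebra.coeff_add, Finsupp.add_apply,
      Finsupp.add_apply, Finsupp.add_apply, hx, hy]
    ring
  | single m r =>
    have h1 : AddMonoidAlgebra.single m r = r • AddMonoidAlgebra.single m (1 : F) := by simp
    rw [h1, map_smul, hD]
    simp only [AddMonoidAlgebra.coeff_smul, AddMonoidAlgebra.coeff_add,
      AddMonoidAlgebra.coeff_single, Finsupp.smul_apply, Finsupp.add_apply, Finsupp.single_apply,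
      smul_eq_mul]
    have h2 : (m - u = g) ↔ (m = g + u) := sub_eq_iff_eq_add
    simp only [zsmul_eq_mul, h2]
    have e1 : (α m : F) * (if m = g then 1 else 0) = (α g : F) * (if m = g then 1 else 0) := by
      split_ifs with h
      · rw [h]
      · simp
    have e2 : (ι m : F) * (if m = g + u then 1 else 0)
        = ((ι g : F) + 1) * (if m = g + u then 1 else 0) := by
      split_ifs with h
      · rw [h, hι]; push_cast; ring
      · simp
    rw [e1, e2]
    ring

/-- The kernel of a first-order operator. -/
theorem gp_ker_D {F G : Type*} [Field F] [CharZero F] [AddCommGroup G]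
    (D : AddMonoidAlgebra F G →ₗ[F] AddMonoidAlgebra F G) (α ι : G → ℤ) (u : G)
    (hα : ∀ g, α (g + u) = α g)
    (hι : ∀ g, ι (g + u) = ι g + 1)
    (hD : ∀ g, D (AddMonoidAlgebra.single g 1) =
      (α g) • AddMonoidAlgebra.single g (1 : F) + (ι g) • AddMonoidAlgebra.single (g - u) (1 : F))
    (f : AddMonoidAlgebra F G) (hf : D f = 0) (g : G) (hg : f.coeff g ≠ 0) :
    α g = 0 ∧ ι g = 0 := by
  have key : ∀ g, (α g : F) * f.coeff g + ((ι g : F) + 1) * f.coeff (g + u) = 0 := by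
    intro g
    rw [← gp_coeff_D D α ι u hι hD f g, hf]
    simp
  have hα0 : α g = 0 := by
    by_contra hne
    have step : ∀ N : ℕ, f.coeff (g + N • u) ≠ 0 ∧ α (g + N • u) = α g ∧
        ι (g + N • u) = ι g + N := by
      intro N
      induction N with
      | zero => simpa using hg
      | succ N ih =>
        obtain ⟨h1, h2, h3⟩ := ih
        have e : g + (N + 1) • u = (g + N • u) + u := by rw [succ_nsmul, add_assoc]
        rw [e]
        refine ⟨?_, by rw [hα, h2], by rw [hι, h3]; push_cast; ring⟩
        intro h0
        have := key (g + N • u)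
        rw [h0, h2, mul_zero, add_zero] at this
        rcases mul_eq_zero.1 this with h | h
        · exact hne (by exact_mod_cast h)
        · exact h1 h
    have hinj : Function.Injective (fun N : ℕ => g + N • u) := by
      intro N M h
      have h1 := (step N).2.2
      have h2 := (step M).2.2
      simp only at h
      rw [h] at h1
      omega
    have hinf := Set.infinite_of_injective_forall_mem (s := (f.coeff.support : Set G)) hinj
      (fun N => by simpa using (step N).1)
    exact hinf f.coeff.support.finite_toSet
  refine ⟨hα0, ?_⟩
  have h := key (g - u)
  have a1 := hα (g - u)
  have i1 := hι (g - u)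
  rw [sub_add_cancel] at a1 i1 h
  rw [← a1, hα0] at h
  have h' : (ι g : F) * f.coeff g = 0 := by
    rw [i1]; push_cast
    simpa using h
  rcases mul_eq_zero.1 h' with h | h
  · exact_mod_cast h
  · exact absurd h hg

/-- Three test monomials force vanishing. -/
theorem gp_vanish {F G : Type*} [Field F] [CharZero F] [AddCommGroup G]
    (P : AddMonoidAlgebra F G) (u w : G) (hu : u ≠ 0) (huw : u + w ≠ 0) (c d c' d' c'' d'' : F)
    (h1 : P = c • AddMonoidAlgebra.single u (1 : F) + d • AddMonoidAlgebra.single 0 (1 : F))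
    (h2 : P * ((2 : ℤ) • AddMonoidAlgebra.single u (1 : F)) =
      c' • AddMonoidAlgebra.single (u + u) (1 : F) + d' • AddMonoidAlgebra.single 0 (1 : F))
    (h3 : P * AddMonoidAlgebra.single w (1 : F) =
      c'' • AddMonoidAlgebra.single w (1 : F) + d'' • AddMonoidAlgebra.single 0 (1 : F)) :
    P = 0 := by
  classical
  rw [h1] at h2 h3
  have e2 := congrArg (fun x => x.coeff u) h2
  have e3 := congrArg (fun x => x.coeff (u + w)) h3
  have n1 : ¬ (0 = u) := fun h => hu h.symm
  have n2 : ¬ (0 = u + w) := fun h => huw h.symm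
  simp [add_mul, AddMonoidAlgebra.single_mul_single, Finsupp.single_apply, hu, n1] at e2
  simp [add_mul, AddMonoidAlgebra.single_mul_single, Finsupp.single_apply, hu, n1, n2] at e3
  rw [h1, e2, e3]
  simp

/-- The Lie algebra `H(n,n)bar` has no nonzero ad-diagonal element
with respect to its monomial basis: if `l ∈ H(n,n)bar` satisfies
`{l, m̄(a,i,b,j)} = c·m̄(a,i,b,j)` for every index `(a,i,b,j) ∈ ℤ^{4n}` (for some
scalar `c ∈ F` depending on the index), then `l = 0`. -/
theorem generalized_poisson_no_ad_diagonal
    (F : Type*) [Field F] [CharZero F] (n : ℕ) (hn : 0 < n)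
    (Dx Dy : Fin n →
      Derivation F (AddMonoidAlgebra F ((Fin n → ℤ) × (Fin n → ℤ) × (Fin n → ℤ) × (Fin n → ℤ)))
        (AddMonoidAlgebra F ((Fin n → ℤ) × (Fin n → ℤ) × (Fin n → ℤ) × (Fin n → ℤ))))
    (hDx : ∀ (k : Fin n) (a i b j : Fin n → ℤ),
      Dx k (AddMonoidAlgebra.single (a, i, b, j) (1 : F)) =
        (a k) • AddMonoidAlgebra.single (a, i, b, j) (1 : F)
          + (i k) • AddMonoidAlgebra.single (a, i - Pi.single k 1, b, j) (1 : F))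
    (hDy : ∀ (k : Fin n) (a i b j : Fin n → ℤ),
      Dy k (AddMonoidAlgebra.single (a, i, b, j) (1 : F)) =
        (b k) • AddMonoidAlgebra.single (a, i, b, j) (1 : F)
          + (j k) • AddMonoidAlgebra.single (a, i, b, j - Pi.single k 1) (1 : F))
    (L : Type*) [LieRing L] [LieAlgebra F L]
    (π : AddMonoidAlgebra F ((Fin n → ℤ) × (Fin n → ℤ) × (Fin n → ℤ) × (Fin n → ℤ)) →ₗ[F] L)
    (hsurj : Function.Surjective π)
    (hker : ∀ f, π f = 0 ↔ ∃ c : F,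
      f = c • (AddMonoidAlgebra.single (0 : (Fin n → ℤ) × (Fin n → ℤ) × (Fin n → ℤ) × (Fin n → ℤ)) (1 : F)))
    (hbr : ∀ f g, ⁅π f, π g⁆ = π (∑ k : Fin n, (Dx k f * Dy k g - Dy k f * Dx k g)))
    (l : L)
    (hl : ∀ a i b j : Fin n → ℤ, ∃ c : F,
      ⁅l, π (AddMonoidAlgebra.single (a, i, b, j) (1 : F))⁆ =
        c • π (AddMonoidAlgebra.single (a, i, b, j) (1 : F))) :
    l = 0 := by
  classical
  obtain ⟨f, rfl⟩ := hsurj l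
  have hl' : ∀ a i b j : Fin n → ℤ, ∃ c d : F,
      ∑ k : Fin n, (Dx k f * Dy k (AddMonoidAlgebra.single (a, i, b, j) (1 : F))
        - Dy k f * Dx k (AddMonoidAlgebra.single (a, i, b, j) (1 : F))) =
      c • AddMonoidAlgebra.single (a, i, b, j) (1 : F) + d • AddMonoidAlgebra.single 0 (1 : F) := by
    intro a i b j
    obtain ⟨c, hc⟩ := hl a i b j
    rw [hbr, ← map_smul, ← sub_eq_zero, ← map_sub] at hc
    obtain ⟨d, hd⟩ := (hker _).1 hc
    exact ⟨c, d, by rw [← hd]; abel⟩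
  have hy : ∀ (k : Fin n) (s t : ℤ), ∃ c d : F,
      Dx k f * (s • AddMonoidAlgebra.single (0, 0, Pi.single k s, Pi.single k t) (1 : F)
        + t • AddMonoidAlgebra.single (0, 0, Pi.single k s, Pi.single k (t - 1)) (1 : F)) =
      c • AddMonoidAlgebra.single (0, 0, Pi.single k s, Pi.single k t) (1 : F)
        + d • AddMonoidAlgebra.single 0 (1 : F) := by
    intro k s t
    obtain ⟨c, d, h⟩ := hl' 0 0 (Pi.single k s) (Pi.single k t)
    refine ⟨c, d, ?_⟩
    rw [← h, Finset.sum_eq_single k]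
    · simp only [hDx, hDy, Pi.single_eq_same, Pi.zero_apply, zero_smul, add_zero, mul_zero,
        sub_zero, Pi.single_sub]
    · intro r _ hr
      simp only [hDx, hDy, Pi.single_eq_of_ne hr, Pi.zero_apply, zero_smul, add_zero, mul_zero,
        sub_zero]
    · simp
  have hx : ∀ (k : Fin n) (s t : ℤ), ∃ c d : F,
      (-Dy k f) * (s • AddMonoidAlgebra.single (Pi.single k s, Pi.single k t, 0, 0) (1 : F)
        + t • AddMonoidAlgebra.single (Pi.single k s, Pi.single k (t - 1), 0, 0) (1 : F)) =
      c • AddMonoidAlgebra.single (Pi.single k s, Pi.single k t, 0, 0) (1 : F)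
        + d • AddMonoidAlgebra.single 0 (1 : F) := by
    intro k s t
    obtain ⟨c, d, h⟩ := hl' (Pi.single k s) (Pi.single k t) 0 0
    refine ⟨c, d, ?_⟩
    rw [← h, Finset.sum_eq_single k]
    · simp only [hDx, hDy, Pi.single_eq_same, Pi.zero_apply, zero_smul, add_zero, mul_zero,
        zero_sub, Pi.single_sub, neg_mul]
    · intro r _ hr
      simp only [hDx, hDy, Pi.single_eq_of_ne hr, Pi.zero_apply, zero_smul, add_zero, mul_zero,
        sub_zero]
    · simp
  have one_eq : AddMonoidAlgebra.single
      (0 : (Fin n → ℤ) × (Fin n → ℤ) × (Fin n → ℤ) × (Fin n → ℤ)) (1 : F) = 1 := rfl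
  have hDx0 : ∀ k, Dx k f = 0 := by
    intro k
    obtain ⟨c, d, h1⟩ := hy k 0 1
    obtain ⟨c', d', h2⟩ := hy k 0 2
    obtain ⟨c'', d'', h3⟩ := hy k 1 0
    refine gp_vanish (Dx k f) (0, 0, 0, Pi.single k 1) (0, 0, Pi.single k 1, 0) ?_ ?_
      c d c' d' c'' d'' ?_ ?_ ?_
    · simp
    · simp
    · simpa [one_eq, ← Prod.zero_eq_mk] using h1
    · simpa [← Pi.single_add] using h2
    · simpa using h3
  have hDy0 : ∀ k, Dy k f = 0 := by
    intro k
    obtain ⟨c, d, h1⟩ := hx k 0 1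
    obtain ⟨c', d', h2⟩ := hx k 0 2
    obtain ⟨c'', d'', h3⟩ := hx k 1 0
    rw [← neg_eq_zero]
    refine gp_vanish (-Dy k f) (0, Pi.single k 1, 0, 0) (Pi.single k 1, 0, 0, 0) ?_ ?_
      c d c' d' c'' d'' ?_ ?_ ?_
    · simp
    · simp
    · simpa [one_eq, ← Prod.zero_eq_mk] using h1
    · simpa [← Pi.single_add] using h2
    · simpa using h3
  have hsupp : ∀ g, f.coeff g ≠ 0 → g = 0 := by
    rintro ⟨a, i, b, j⟩ hg
    have kx : ∀ k, a k = 0 ∧ i k = 0 := fun k =>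
      gp_ker_D (Dx k : _ →ₗ[F] _) (fun g => g.1 k) (fun g => g.2.1 k) (0, Pi.single k 1, 0, 0)
        (by simp) (by simp)
        (by
          rintro ⟨a, i, b, j⟩
          simpa only [Prod.mk_sub_mk, sub_zero, Derivation.coeFn_coe] using hDx k a i b j) f (hDx0 k) _ hg
    have ky : ∀ k, b k = 0 ∧ j k = 0 := fun k =>
      gp_ker_D (Dy k : _ →ₗ[F] _) (fun g => g.2.2.1 k) (fun g => g.2.2.2 k)
        (0, 0, 0, Pi.single k 1)
        (by simp) (by simp)
        (by
          rintro ⟨a, i, b, j⟩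
          simpa only [Prod.mk_sub_mk, sub_zero, Derivation.coeFn_coe] using hDy k a i b j) f (hDy0 k) _ hg
    have ha : a = 0 := funext fun k => (kx k).1
    have hi : i = 0 := funext fun k => (kx k).2
    have hb : b = 0 := funext fun k => (ky k).1
    have hj : j = 0 := funext fun k => (ky k).2
    rw [ha, hi, hb, hj]
    rfl
  rw [hker]
  refine ⟨f.coeff 0, ?_⟩
  ext g
  by_cases h0 : g = 0
  · subst h0; simp
  · have : f.coeff g = 0 := by
      by_contra h
      exact h0 (hsupp g h)
    rw [this]
    simp [Finsupp.single_apply, Ne.symm h0]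
end
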